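/- There exists a universal constant C such that the following holds. In the weakly observable graph setting with implicit-exploration parameter γ ∈ (0, 1/2], exploration level ε ∈ (0,1) and learning rate η > 0, assume that for every round t and every node i ∉ S_t one has W_{t,i} ≥ ε, and that the distributions p_t are exponential-weights iterates on the estimated losses: p_1 is uniform and p_{t+1,i} ∝ p_{t,i} exp(−η ℓ̂_{t,i}). Let α̃_t denote the independence number of the subgraph of G_t induced on S_t. Then for every δ ∈ (0,1), with probability at least 1 − δ, simultaneously for every arm j ∈ [K], Σ_{t=1}^T ⟨p_t − e_j, ℓ̂_t⟩ ≤ (log K)/η + C · log(KT/(γδ)) · ( η Σ_{t=1}^T α̃_t + (η/γ) · (max_{t∈[T]} α̃_t) · log(1/δ) ) + η √( (T/ε³) · log(2/δ) ) + (η/ε²) · log(2/δ) + ηT/ε. -/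

import Mathlib

open MeasureTheory

section Graph

variable {ι : Type*} [DecidableEq ι]

/-- A weighted Turán-type bound for directed graphs with self-loops. -/
theorem exists_independent_of_inWeight_le (N : ι → Finset ι) (q : ι → ℝ) (hq : ∀ i, 0 ≤ q i)
    (w : ℝ) (H : Finset ι) (hself : ∀ i ∈ H, i ∈ N i)
    (hw : ∀ i ∈ H, ∑ j ∈ H with j ∈ N i, q j ≤ w) :
    ∃ A ⊆ H, (∀ i ∈ A, ∀ j ∈ A, i ≠ j → i ∉ N j) ∧ ∑ i ∈ H, q i ≤ 2 * w * A.card := by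
  induction H using Finset.strongInduction with
  | H H ih =>
  rcases (Finset.sum_nonneg fun i (_ : i ∈ H) => hq i).eq_or_lt' with h0 | hpos
  · exact ⟨∅, by simp, by simp, by simp [h0]⟩
  have hdc : ∑ i ∈ H, q i * ∑ j ∈ H with i ∈ N j, q j
      = ∑ i ∈ H, q i * ∑ j ∈ H with j ∈ N i, q j := by
    simp only [Finset.mul_sum, Finset.sum_filter]
    rw [Finset.sum_comm]
    refine Finset.sum_congr rfl fun i _ => Finset.sum_congr rfl fun j _ => ?_
    split_ifs <;> ring
  obtain ⟨i, hi, hiw⟩ : ∃ i ∈ H,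
      ∑ j ∈ H with j ∈ N i, q j + ∑ j ∈ H with i ∈ N j, q j ≤ 2 * w := by
    by_contra! hcon
    obtain ⟨i₀, hi₀, hqi₀⟩ : ∃ i ∈ H, 0 < q i := by
      by_contra! h
      exact absurd (Finset.sum_nonpos h) (not_le.2 hpos)
    have h1 : ∑ i ∈ H, q i * (2 * w) < ∑ i ∈ H, q i *
        (∑ j ∈ H with j ∈ N i, q j + ∑ j ∈ H with i ∈ N j, q j) :=
      Finset.sum_lt_sum (fun i hi => mul_le_mul_of_nonneg_left (hcon i hi).le (hq i))
        ⟨i₀, hi₀, mul_lt_mul_of_pos_left (hcon i₀ hi₀) hqi₀⟩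
    simp only [mul_add, Finset.sum_add_distrib] at h1
    rw [hdc] at h1
    have h2 : ∑ i ∈ H, q i * ∑ j ∈ H with j ∈ N i, q j ≤ ∑ i ∈ H, q i * w :=
      Finset.sum_le_sum fun i hi => mul_le_mul_of_nonneg_left (hw i hi) (hq i)
    rw [← Finset.sum_mul] at h1 h2
    linarith
  set H' := H.filter fun j => j ∉ N i ∧ i ∉ N j with hH'
  have hsub : H' ⊆ H := Finset.filter_subset _ _
  have hss : H' ⊂ H := Finset.ssubset_iff_subset_ne.2 ⟨hsub, fun h => by
    rw [← h, hH', Finset.mem_filter] at hi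
    exact hi.2.1 (hself i hi.1)⟩
  obtain ⟨A, hA, hind, hcard⟩ := ih H' hss (fun j hj => hself j (hsub hj)) fun j hj =>
    (Finset.sum_le_sum_of_subset_of_nonneg (Finset.filter_subset_filter _ hsub)
      fun k _ _ => hq k).trans (hw j (hsub hj))
  have hiA : i ∉ A := fun h => by
    have := Finset.mem_filter.1 (hA h)
    exact this.2.1 (hself i hi)
  refine ⟨insert i A, Finset.insert_subset hi (hA.trans hsub), ?_, ?_⟩
  · intro a ha b hb hab
    rcases Finset.mem_insert.1 ha with rfl | ha' <;> rcases Finset.mem_insert.1 hb with rfl | hb'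
    · exact absurd rfl hab
    · exact (Finset.mem_filter.1 (hA hb')).2.2
    · exact (Finset.mem_filter.1 (hA ha')).2.1
    · exact hind a ha' b hb' hab
  · rw [Finset.card_insert_of_notMem hiA]
    push_cast
    have hsplit : ∑ j ∈ H, q j ≤ ∑ j ∈ H', q j +
        (∑ j ∈ H with j ∈ N i, q j + ∑ j ∈ H with i ∈ N j, q j) := by
      simp only [hH', Finset.sum_filter, ← Finset.sum_add_distrib]
      refine Finset.sum_le_sum fun j _ => ?_
      have := hq j
      by_cases h1 : j ∈ N i <;> by_cases h2 : i ∈ N j <;> simp [h1, h2, this]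
    linarith

theorem exists_inWeight_ge (N : ι → Finset ι) (q : ι → ℝ) (hq : ∀ i, 0 ≤ q i) (α : ℝ)
    (hα : ∀ A : Finset ι, (∀ i ∈ A, i ∈ N i) → (∀ i ∈ A, ∀ j ∈ A, i ≠ j → i ∉ N j) →
      (A.card : ℝ) ≤ α)
    (H : Finset ι) (hH : H.Nonempty) (hself : ∀ i ∈ H, i ∈ N i) :
    ∃ i ∈ H, ∑ j ∈ H, q j ≤ 2 * α * ∑ j ∈ N i, q j := by
  obtain ⟨i, hi, hmax⟩ := H.exists_max_image (fun i => ∑ j ∈ N i, q j) hH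
  obtain ⟨A, hA, hind, hle⟩ := exists_independent_of_inWeight_le N q hq (∑ j ∈ N i, q j) H hself
    fun k hk => (Finset.sum_le_sum_of_subset_of_nonneg
      (fun j hj => (Finset.mem_filter.1 hj).2) fun j _ _ => hq j).trans (hmax k hk)
  refine ⟨i, hi, hle.trans ?_⟩
  have h1 := hα A (fun j hj => hself j (hA hj)) hind
  have h2 : 0 ≤ ∑ j ∈ N i, q j := Finset.sum_nonneg fun j _ => hq j
  nlinarith

theorem sum_div_le_log (q d : ι → ℝ) (hq : ∀ i, 0 ≤ q i) {a w : ℝ} (ha : 0 < a) (hw : 0 < w)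
    (H : Finset ι)
    (hd : ∀ H' ⊆ H, H'.Nonempty → ∃ i ∈ H', (∑ j ∈ H', q j) / a + w ≤ d i) :
    ∑ i ∈ H, q i / d i ≤ a * Real.log (1 + (∑ i ∈ H, q i) / (a * w)) := by
  induction H using Finset.strongInduction with
  | H H ih =>
  rcases H.eq_empty_or_nonempty with rfl | hne
  · simp
  obtain ⟨i, hi, hdi⟩ := hd H subset_rfl hne
  have hIH := ih (H.erase i) (Finset.erase_ssubset hi)
    fun H' h' => hd H' (h'.trans (Finset.erase_subset _ _))
  rw [← Finset.add_sum_erase H _ hi]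
  rw [← Finset.add_sum_erase H q hi] at hdi ⊢
  set P := ∑ j ∈ H.erase i, q j
  have hP : 0 ≤ P := Finset.sum_nonneg fun j _ => hq j
  have hqi := hq i
  have hD' : 0 < P / a + w := by positivity
  have hD : 0 < (q i + P) / a + w := by positivity
  have h1 : q i / d i ≤ q i / ((q i + P) / a + w) := div_le_div_of_nonneg_left hqi hD hdi
  have e1 : 1 + P / (a * w) = (P / a + w) / w := by field_simp; ring
  have e2 : 1 + (q i + P) / (a * w) = ((q i + P) / a + w) / w := by field_simp; ring
  rw [e1, Real.log_div hD'.ne' hw.ne'] at hIH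
  rw [e2, Real.log_div hD.ne' hw.ne']
  have h2 := Real.one_sub_inv_le_log_of_pos (div_pos hD hD')
  rw [Real.log_div hD.ne' hD'.ne', inv_div] at h2
  have h3 : 1 - (P / a + w) / ((q i + P) / a + w) = q i / ((q i + P) / a + w) / a := by
    field_simp; ring
  rw [h3, div_le_iff₀ ha] at h2
  linarith

theorem sum_div_sq_le (q d : ι → ℝ) (hq : ∀ i, 0 ≤ q i) {a w : ℝ} (ha : 0 < a) (hw : 0 < w)
    (H : Finset ι)
    (hd : ∀ H' ⊆ H, H'.Nonempty → ∃ i ∈ H', (∑ j ∈ H', q j) / a + w ≤ d i) :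
    ∑ i ∈ H, q i / d i ^ 2 ≤ a * (1 / w - 1 / ((∑ i ∈ H, q i) / a + w)) := by
  induction H using Finset.strongInduction with
  | H H ih =>
  rcases H.eq_empty_or_nonempty with rfl | hne
  · simp
  obtain ⟨i, hi, hdi⟩ := hd H subset_rfl hne
  have hIH := ih (H.erase i) (Finset.erase_ssubset hi)
    fun H' h' => hd H' (h'.trans (Finset.erase_subset _ _))
  rw [← Finset.add_sum_erase H _ hi]
  rw [← Finset.add_sum_erase H q hi] at hdi ⊢
  set P := ∑ j ∈ H.erase i, q j
  have hP : 0 ≤ P := Finset.sum_nonneg fun j _ => hq j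
  have hqi := hq i
  have hD' : 0 < P / a + w := by positivity
  have hD : 0 < (q i + P) / a + w := by positivity
  have hDD : P / a + w ≤ (q i + P) / a + w := by gcongr; linarith
  have h1 : q i / d i ^ 2 ≤ q i / (((q i + P) / a + w) * (P / a + w)) := by
    apply div_le_div_of_nonneg_left hqi (by positivity)
    nlinarith
  have h2 : q i / (((q i + P) / a + w) * (P / a + w))
      = a * (1 / (P / a + w) - 1 / ((q i + P) / a + w)) := by
    field_simp; ring
  linarith

/-- Estimates on the variance proxies of importance-weighted losses on looped nodes. -/
theorem looped_sum_bounds [Fintype ι] (N : ι → Finset ι) (q : ι → ℝ) (hq : ∀ i, 0 ≤ q i)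
    (hq1 : ∑ i, q i = 1) (α : ℝ)
    (hα : ∀ A : Finset ι, (∀ i ∈ A, i ∈ N i) → (∀ i ∈ A, ∀ j ∈ A, i ≠ j → i ∉ N j) →
      (A.card : ℝ) ≤ α) {γ : ℝ} (hγ : 0 < γ) (hγ2 : γ ≤ 1 / 2) (H : Finset ι)
    (hself : ∀ i ∈ H, i ∈ N i) :
    ∑ i ∈ H, q i / (∑ j ∈ N i, q j + γ) ≤ 2 * α * Real.log (1 / γ) ∧
    ∑ i ∈ H, q i / (∑ j ∈ N i, q j + γ) ^ 2 ≤ 2 * α / γ ∧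
    (∀ κ : ℝ, 0 < κ → κ ≤ 1 / 2 → (∀ i ∈ H, ∑ j ∈ N i, q j ≤ γ / κ) →
      ∑ i ∈ H, q i / (∑ j ∈ N i, q j + γ) ≤ 4 * α * Real.log (1 / κ)) ∧
    (∀ κ : ℝ, 0 < κ → (∀ i ∈ H, γ / κ ≤ ∑ j ∈ N i, q j) →
      ∑ i ∈ H, q i / (∑ j ∈ N i, q j + γ) ^ 2 ≤ 8 * α * κ / γ) := by
  rcases H.eq_empty_or_nonempty with rfl | hne
  · have h0 : 0 ≤ α := by simpa using hα ∅ (by simp) (by simp)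
    have hl : 0 ≤ Real.log (1 / γ) := Real.log_nonneg (by rw [le_div_iff₀ hγ]; linarith)
    refine ⟨by simp; simp at hl; nlinarith, by simp; positivity, fun κ hκ hκ2 _ => ?_,
      fun κ hκ _ => by simp; positivity⟩
    have hl : 0 ≤ Real.log (1 / κ) := Real.log_nonneg (by rw [le_div_iff₀ hκ]; linarith)
    simp only [Finset.sum_empty]
    positivity
  have hα1 : 1 ≤ α := by
    obtain ⟨i, hi⟩ := hne
    simpa using hα {i} (by simpa using hself i hi) (by simp)
  have ha : 0 < 2 * α := by linarith
  have hheavy : ∀ H' ⊆ H, H'.Nonempty → ∃ i ∈ H',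
      (∑ j ∈ H', q j) / (2 * α) ≤ ∑ j ∈ N i, q j := fun H' h' hn => by
    obtain ⟨i, hi, hle⟩ := exists_inWeight_ge N q hq α hα H' hn fun j hj => hself j (h' hj)
    exact ⟨i, hi, by rw [div_le_iff₀ ha]; linarith⟩
  have hd : ∀ H' ⊆ H, H'.Nonempty → ∃ i ∈ H',
      (∑ j ∈ H', q j) / (2 * α) + γ ≤ ∑ j ∈ N i, q j + γ := fun H' h' hn => by
    obtain ⟨i, hi, hle⟩ := hheavy H' h' hn
    exact ⟨i, hi, by linarith⟩
  have hP0 : 0 ≤ ∑ i ∈ H, q i := Finset.sum_nonneg fun j _ => hq j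
  have hP1 : ∑ i ∈ H, q i ≤ 1 := hq1 ▸
    Finset.sum_le_sum_of_subset_of_nonneg (Finset.subset_univ _) fun j _ _ => hq j
  have hlog := sum_div_le_log q _ hq ha hγ H hd
  refine ⟨hlog.trans ?_, (sum_div_sq_le q _ hq ha hγ H hd).trans ?_, fun κ hκ hκ2 hW => ?_,
    fun κ hκ hW => ?_⟩
  · gcongr
    rw [add_comm, ← le_sub_iff_add_le, div_le_iff₀ (by positivity)]
    have : (1 / γ - 1) * (2 * α * γ) = (1 - γ) * (2 * α) := by field_simp
    rw [this]
    nlinarith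
  · have : 0 ≤ 1 / ((∑ i ∈ H, q i) / (2 * α) + γ) := by positivity
    calc _ ≤ 2 * α * (1 / γ) := by gcongr; linarith
      _ = _ := by ring
  · obtain ⟨i, hi, hle⟩ := hheavy H subset_rfl hne
    have h1 : (∑ j ∈ H, q j) / (2 * α * γ) ≤ 1 / κ := by
      rw [← div_div, div_le_iff₀ hγ]
      calc _ ≤ _ := hle.trans (hW i hi)
        _ = _ := by ring
    refine hlog.trans ?_
    have h2 : Real.log (1 + (∑ j ∈ H, q j) / (2 * α * γ)) ≤ 2 * Real.log (1 / κ) := by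
      rw [← Real.log_rpow (by positivity)]
      refine Real.log_le_log (by positivity) ?_
      have h3 : 2 ≤ 1 / κ := by rw [le_div_iff₀ hκ]; linarith
      have : (1 / κ) ^ (2 : ℝ) = (1 / κ) ^ 2 := by norm_cast
      rw [this]
      nlinarith
    nlinarith
  · have hd2 : ∀ H' ⊆ H, H'.Nonempty → ∃ i ∈ H',
        (∑ j ∈ H', q j) / (2 * α) + γ / κ ≤ 2 * (∑ j ∈ N i, q j + γ) := fun H' h' hn => by
      obtain ⟨i, hi, hle⟩ := hheavy H' h' hn
      have := hW i (h' hi)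
      exact ⟨i, hi, by linarith⟩
    have h1 := sum_div_sq_le q _ hq ha (div_pos hγ hκ) H hd2
    have h2 : 0 ≤ 1 / ((∑ i ∈ H, q i) / (2 * α) + γ / κ) := by positivity
    have h3 : ∑ i ∈ H, q i / (∑ j ∈ N i, q j + γ) ^ 2
        = 4 * ∑ i ∈ H, q i / (2 * (∑ j ∈ N i, q j + γ)) ^ 2 := by
      rw [Finset.mul_sum]
      refine Finset.sum_congr rfl fun i _ => ?_
      rw [mul_pow, ← div_div]
      ring
    rw [h3]
    calc _ ≤ 4 * (2 * α * (1 / (γ / κ))) := by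
          gcongr
          refine h1.trans ?_
          gcongr
          linarith
      _ = _ := by rw [one_div_div]; ring

end Graph

theorem exp_neg_le_quadratic {x : ℝ} (hx : 0 ≤ x) : Real.exp (-x) ≤ 1 - x + x ^ 2 / 2 := by
  rw [Real.exp_neg]
  have h := Real.quadratic_le_exp_of_nonneg hx
  refine inv_le_of_inv_le₀ (by nlinarith [sq_nonneg (x - 1)]) (le_trans ?_ h)
  refine inv_le_of_inv_le₀ (by positivity) ?_
  rw [inv_le_iff_one_le_mul₀ (by positivity)]
  nlinarith [sq_nonneg (x ^ 2)]

/-- The second-order regret bound for exponential weights with nonnegative losses. -/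
theorem exp_weights_regret {K T : ℕ} (hK : 0 < K) {p l : ℕ → Fin K → ℝ} {η : ℝ} (hη : 0 < η)
    (hpnn : ∀ t i, 0 ≤ p t i) (hpsum : ∀ t, ∑ i, p t i = 1) (hl : ∀ t i, 0 ≤ l t i)
    (hp1 : ∀ i, p 1 i = 1 / K)
    (hupdate : ∀ t, 1 ≤ t → t ≤ T → ∀ i, p (t + 1) i =
      p t i * Real.exp (-η * l t i) / ∑ j, p t j * Real.exp (-η * l t j)) (j : Fin K) :
    ∑ t ∈ Finset.Icc 1 T, ∑ i, (p t i - (if i = j then (1 : ℝ) else 0)) * l t i ≤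
      Real.log K / η + η / 2 * ∑ t ∈ Finset.Icc 1 T, ∑ i, p t i * l t i ^ 2 := by
  have hstep : ∀ t, ∑ i, p t i * Real.exp (-η * l t i) ≤
      Real.exp (-η * ∑ i, p t i * l t i + η ^ 2 / 2 * ∑ i, p t i * l t i ^ 2) := fun t => by
    refine le_trans ?_ (Real.add_one_le_exp _)
    rw [← hpsum t, Finset.mul_sum, Finset.mul_sum, ← Finset.sum_add_distrib,
      ← Finset.sum_add_distrib]
    refine Finset.sum_le_sum fun i _ => ?_
    have h := exp_neg_le_quadratic (mul_nonneg hη.le (hl t i))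
    rw [← neg_mul] at h
    calc _ ≤ _ := mul_le_mul_of_nonneg_left h (hpnn t i)
      _ = _ := by ring
  have hinner : ∀ t, ∑ i, (p t i - (if i = j then (1 : ℝ) else 0)) * l t i
      = ∑ i, p t i * l t i - l t j := fun t => by
    simp [sub_mul, Finset.sum_sub_distrib]
  have hK' : (0 : ℝ) < K := by positivity
  have key : ∀ n, n ≤ T → Real.exp (∑ t ∈ Finset.Icc 1 n, (η *
      ∑ i, (p t i - (if i = j then (1 : ℝ) else 0)) * l t i
        - η ^ 2 / 2 * ∑ i, p t i * l t i ^ 2)) ≤ K * p (n + 1) j := by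
    intro n
    induction n with
    | zero =>
      intro _
      have : (K : ℝ) ≠ 0 := by positivity
      simp [hp1, this]
    | succ n ih =>
      intro hn
      specialize ih (by omega)
      rw [Finset.sum_Icc_succ_top (by omega), Real.exp_add, hupdate (n + 1) (by omega) hn, hinner]
      set Z := ∑ i, p (n + 1) i * Real.exp (-η * l (n + 1) i)
      have hZ : 0 < Z := by
        by_contra! hle
        have hz : ∀ i ∈ Finset.univ, p (n + 1) i * Real.exp (-η * l (n + 1) i) = 0 :=
          (Finset.sum_eq_zero_iff_of_nonneg fun i _ =>
            mul_nonneg (hpnn _ _) (Real.exp_pos _).le).1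
            (le_antisymm hle (Finset.sum_nonneg fun i _ =>
              mul_nonneg (hpnn _ _) (Real.exp_pos _).le))
        have h0 : ∑ i, p (n + 1) i = 0 := Finset.sum_eq_zero fun i hi => by
          have := hz i hi
          simpa [(Real.exp_pos _).ne'] using this
        rw [hpsum] at h0
        exact one_ne_zero h0
      rw [← mul_div_assoc, le_div_iff₀ hZ]
      calc _ ≤ (K * p (n + 1) j) * Real.exp (η * (∑ i, p (n + 1) i * l (n + 1) i - l (n + 1) j)
            - η ^ 2 / 2 * ∑ i, p (n + 1) i * l (n + 1) i ^ 2) *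
            Real.exp (-η * ∑ i, p (n + 1) i * l (n + 1) i
              + η ^ 2 / 2 * ∑ i, p (n + 1) i * l (n + 1) i ^ 2) := by
            exact mul_le_mul (mul_le_mul_of_nonneg_right ih (Real.exp_pos _).le) (hstep _)
              (Finset.sum_nonneg fun i _ => mul_nonneg (hpnn _ _) (Real.exp_pos _).le)
              (mul_nonneg (mul_nonneg hK'.le (hpnn _ _)) (Real.exp_pos _).le)
        _ = _ := by
            rw [mul_assoc, ← Real.exp_add, mul_assoc]
            congr 3
            ring
  have hfin := key T le_rfl
  have hle1 : p (T + 1) j ≤ 1 := hpsum (T + 1) ▸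
    Finset.single_le_sum (fun i _ => hpnn (T + 1) i) (Finset.mem_univ j)
  have h2 : Real.exp (∑ t ∈ Finset.Icc 1 T, (η *
      ∑ i, (p t i - (if i = j then (1 : ℝ) else 0)) * l t i
        - η ^ 2 / 2 * ∑ i, p t i * l t i ^ 2)) ≤ K := hfin.trans (by nlinarith)
  rw [← Real.le_log_iff_exp_le hK', Finset.sum_sub_distrib, ← Finset.mul_sum,
    ← Finset.mul_sum] at h2
  rw [← sub_le_iff_le_add, le_div_iff₀ hη]
  linarith

/-- A nonincreasing cutoff, equal to `1` up to `1` and to `0` from `2` on. -/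
noncomputable def cutoff (v : ℝ) : ℝ := (max (1 - max (v - 1) 0 ^ 2) 0) ^ 2

theorem cutoff_nonneg (v : ℝ) : 0 ≤ cutoff v := sq_nonneg _

theorem cutoff_of_le_one {v : ℝ} (hv : v ≤ 1) : cutoff v = 1 := by
  rw [cutoff, max_eq_right (by linarith : v - 1 ≤ 0)]
  norm_num

theorem cutoff_of_two_le {v : ℝ} (hv : 2 ≤ v) : cutoff v = 0 := by
  rw [cutoff, max_eq_left (by linarith : 0 ≤ v - 1), max_eq_right (by nlinarith)]
  norm_num

theorem cutoff_of_mem {v : ℝ} (h1 : 1 ≤ v) (h2 : v ≤ 2) : cutoff v = (1 - (v - 1) ^ 2) ^ 2 := by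
  rw [cutoff, max_eq_left (by linarith : 0 ≤ v - 1), max_eq_left (by nlinarith)]

theorem antitone_cutoff : Antitone cutoff := fun a b hab => by
  unfold cutoff
  gcongr

theorem cutoff_le_one (v : ℝ) : cutoff v ≤ 1 := by
  rcases le_total v 1 with h | h
  · exact (cutoff_of_le_one h).le
  · exact (antitone_cutoff h).trans (cutoff_of_le_one le_rfl).le

theorem measurable_cutoff : Measurable cutoff := by
  unfold cutoff
  fun_prop

/-- The absolute value of the derivative of `cutoff`. -/
noncomputable def cutoffSlope (v : ℝ) : ℝ :=
  4 * max (v - 1) 0 * max (1 - max (v - 1) 0 ^ 2) 0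

theorem cutoffSlope_nonneg (v : ℝ) : 0 ≤ cutoffSlope v := by
  unfold cutoffSlope
  positivity

theorem cutoffSlope_of_le_one {v : ℝ} (hv : v ≤ 1) : cutoffSlope v = 0 := by
  rw [cutoffSlope, max_eq_right (by linarith : v - 1 ≤ 0)]
  norm_num

theorem cutoffSlope_of_two_le {v : ℝ} (hv : 2 ≤ v) : cutoffSlope v = 0 := by
  rw [cutoffSlope, max_eq_left (by linarith : 0 ≤ v - 1), max_eq_right (by nlinarith)]
  norm_num

theorem cutoffSlope_of_mem {v : ℝ} (h1 : 1 ≤ v) (h2 : v ≤ 2) :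
    cutoffSlope v = 4 * (v - 1) * (1 - (v - 1) ^ 2) := by
  rw [cutoffSlope, max_eq_left (by linarith : 0 ≤ v - 1), max_eq_left (by nlinarith)]

theorem cutoff_add_ge_taylor (v : ℝ) {y : ℝ} (hy : 0 ≤ y) :
    cutoff v - cutoffSlope v * y - 2 * cutoff v * y ^ 2 ≤ cutoff (v + y) := by
  have key : ∀ u : ℝ, 0 ≤ u → u ≤ 1 →
      cutoff (1 + u) - cutoffSlope (1 + u) * y - 2 * cutoff (1 + u) * y ^ 2
        ≤ cutoff (1 + u + y) := by
    intro u h0 h1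
    rw [cutoff_of_mem (by linarith) (by linarith), cutoffSlope_of_mem (by linarith) (by linarith)]
    have e : 1 + u - 1 = u := by ring
    rw [e]
    rcases le_total (1 + u + y) 2 with h | h
    · rw [cutoff_of_mem (by linarith) h]
      have e1 : (1 - (1 + u + y - 1) ^ 2) ^ 2 - ((1 - u ^ 2) ^ 2 - 4 * u * (1 - u ^ 2) * y
          - 2 * (1 - u ^ 2) ^ 2 * y ^ 2)
          = y ^ 2 * ((2 * u + y) ^ 2 - 2 * (1 - u ^ 2) * u ^ 2) := by ring
      have e2 : 0 ≤ (2 * u + y) ^ 2 - 2 * (1 - u ^ 2) * u ^ 2 := by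
        nlinarith [mul_nonneg h0 hy, sq_nonneg y, sq_nonneg u, sq_nonneg (u ^ 2)]
      nlinarith [mul_nonneg (sq_nonneg y) e2]
    · refine le_trans ?_ (cutoff_nonneg _)
      have hD : 0 ≤ 1 - u ^ 2 := by nlinarith
      have hyu : 1 - u ≤ y := by linarith
      have e1 : (1 + u) * (1 - 2 * (1 - u) ^ 2) - 4 * u ≤ 0 := by
        nlinarith [mul_nonneg h0 (sub_nonneg.2 h1), sq_nonneg (u - 1 / 2),
          mul_nonneg h0 (sq_nonneg (u - 1 / 2)), mul_nonneg h0 (sq_nonneg (u - 1)), sq_nonneg u]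
      have e2 : (1 - u ^ 2) * (1 - 2 * y ^ 2) - 4 * u * y ≤ 0 := by
        have h3 : (1 - u) ^ 2 ≤ y ^ 2 := by nlinarith
        have h4 : 4 * u * (1 - u) ≤ 4 * u * y := by nlinarith
        nlinarith [mul_nonneg hD (sub_nonneg.2 h3), mul_nonneg (sub_nonneg.2 h1) (neg_nonneg.2 e1)]
      nlinarith [mul_nonneg hD (neg_nonneg.2 e2)]
  rcases le_total v 1 with h | h
  · have h1 := key 0 le_rfl zero_le_one
    rw [add_zero, cutoff_of_le_one le_rfl, cutoffSlope_of_le_one le_rfl] at h1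
    rw [cutoff_of_le_one h, cutoffSlope_of_le_one h]
    exact h1.trans (antitone_cutoff (by linarith))
  · rcases le_total v 2 with h2 | h2
    · have h1 := key (v - 1) (by linarith) (by linarith)
      simpa using h1
    · rw [cutoff_of_two_le h2, cutoffSlope_of_two_le h2]
      simpa using cutoff_nonneg _

theorem cutoff_add_ge (v : ℝ) {y₁ y₂ : ℝ} (h1 : 0 ≤ y₁) (h2 : 0 ≤ y₂) :
    cutoff v - cutoffSlope v * (y₁ + y₂) - 4 * cutoff v * (y₁ ^ 2 + y₂) ≤
      cutoff (v + (y₁ + y₂)) := by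
  have hf := cutoff_nonneg v
  have hs := cutoffSlope_nonneg v
  rcases le_total (y₁ + y₂) 1 with h | h
  · refine le_trans ?_ (cutoff_add_ge_taylor v (add_nonneg h1 h2))
    have : (y₁ + y₂) ^ 2 ≤ 2 * (y₁ ^ 2 + y₂) := by nlinarith [sq_nonneg (y₁ - y₂)]
    nlinarith
  · refine le_trans ?_ (cutoff_nonneg _)
    have : 1 / 4 ≤ y₁ ^ 2 + y₂ := by nlinarith [sq_nonneg (y₁ - 1 / 2)]
    nlinarith [mul_nonneg hs (add_nonneg h1 h2)]

theorem cutoffSlope_mul_le {v ρ : ℝ} (hρ0 : 0 ≤ ρ) (hv : v ≤ 2) (hv0 : 0 ≤ v) :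
    cutoffSlope ((1 - ρ) * v) * ρ ≤ 2 * cutoff ((1 - ρ) * v) ∧
    cutoff v ≤ cutoff ((1 - ρ) * v) - cutoffSlope ((1 - ρ) * v) * (ρ / 32) := by
  rcases le_total ((1 - ρ) * v) 1 with h | h
  · rw [cutoffSlope_of_le_one h, cutoff_of_le_one h]
    simpa using cutoff_le_one v
  have hle : (1 - ρ) * v ≤ v := by nlinarith
  rw [cutoffSlope_of_mem h (hle.trans hv), cutoff_of_mem h (hle.trans hv),
    cutoff_of_mem (h.trans hle) hv]
  obtain ⟨u, hu⟩ : ∃ u, u = (1 - ρ) * v - 1 := ⟨_, rfl⟩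
  obtain ⟨r, hr⟩ : ∃ r, r = ρ * v := ⟨_, rfl⟩
  have e : v - 1 = u + r := by rw [hu, hr]; ring
  have hu0 : 0 ≤ u := by linarith
  have hρr : ρ ≤ r := by rw [hr]; nlinarith
  have hur : u + r ≤ 1 := by linarith
  rw [← hu, e]
  have hD : 0 ≤ 1 - u ^ 2 := by nlinarith
  have hE0 : 2 * u * ρ ≤ 2 * u * r + r ^ 2 := by nlinarith [mul_nonneg hu0 (sub_nonneg.2 hρr)]
  have hE1 : 2 * u * r + r ^ 2 ≤ 1 - u ^ 2 := by nlinarith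
  constructor
  · have : 2 * u * ρ ≤ 1 - u ^ 2 := by linarith
    nlinarith
  · have h3 : (1 - (u + r) ^ 2) ^ 2 = (1 - u ^ 2) ^ 2
        - (2 * u * r + r ^ 2) * (2 * (1 - u ^ 2) - (2 * u * r + r ^ 2)) := by ring
    rw [h3]
    have h4 : 2 * u * ρ * (1 - u ^ 2) ≤
        (2 * u * r + r ^ 2) * (2 * (1 - u ^ 2) - (2 * u * r + r ^ 2)) := by
      apply mul_le_mul hE0 (by linarith) hD (by nlinarith)
    nlinarith [mul_nonneg (mul_nonneg hu0 hρ0) hD]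

theorem exp_le_one_add_mul_of_le_one {x : ℝ} (h0 : 0 ≤ x) (h1 : x ≤ 1) : Real.exp x ≤ 1 + 7 / 4 * x := by
  have h := convexOn_exp.2 (Set.mem_univ 0) (Set.mem_univ 1) (sub_nonneg.2 h1) h0 (by ring)
  simp at h
  have := Real.exp_one_lt_d9
  nlinarith

/-- One step of the potential argument: `cutoff` controls the heavy-tailed variables and
the exponential factor the bounded ones. -/
theorem potential_step {ι : Type*} [Fintype ι] (p y₁ y₂ x : ι → ℝ) (hp : ∀ k, 0 ≤ p k)
    (hp1 : ∑ k, p k = 1) (hy₁ : ∀ k, 0 ≤ y₁ k) (hy₂ : ∀ k, 0 ≤ y₂ k) (hx0 : ∀ k, 0 ≤ x k)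
    (hx1 : ∀ k, x k ≤ 1) {U B B' h e Ψ : ℝ} (hU : 0 ≤ U) (hB : 0 < B) (hBB : B ≤ B')
    (hmean : ∑ k, p k * (y₁ k + y₂ k) ≤ (B' - B) / 32)
    (hvar : ∑ k, p k * ((y₁ k / B') ^ 2 + y₂ k / B') ≤ h) (hh : h ≤ 1 / 64)
    (hxm : ∑ k, p k * x k ≤ e) (hΨ : 0 ≤ Ψ) :
    Real.exp (-(16 * h)) * (cutoff (U / B) * max (1 - Ψ) 0) ≤
      ∑ k, p k * (cutoff ((U + (y₁ k + y₂ k)) / B') *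
        max (1 - Ψ * Real.exp (x k - 2 * e)) 0) := by
  have hB' : 0 < B' := hB.trans_le hBB
  have hnn : 0 ≤ ∑ k, p k * (cutoff ((U + (y₁ k + y₂ k)) / B') *
        max (1 - Ψ * Real.exp (x k - 2 * e)) 0) := Finset.sum_nonneg fun k _ =>
    mul_nonneg (hp k) (mul_nonneg (cutoff_nonneg _) (le_max_right _ _))
  rcases le_total (1 - Ψ) 0 with hneg | hG
  · rwa [max_eq_right hneg, mul_zero, mul_zero]
  rcases le_total 2 (U / B) with hV | hV
  · rwa [cutoff_of_two_le hV, zero_mul, mul_zero]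
  rw [max_eq_left hG]
  have hh0 : 0 ≤ h := le_trans (Finset.sum_nonneg fun k _ => mul_nonneg (hp k)
    (add_nonneg (sq_nonneg _) (div_nonneg (hy₂ k) hB'.le))) hvar
  have he0 : 0 ≤ e := le_trans (Finset.sum_nonneg fun k _ => mul_nonneg (hp k) (hx0 k)) hxm
  obtain ⟨ρ, hρ⟩ : ∃ ρ, ρ = (B' - B) / B' := ⟨_, rfl⟩
  have hρ0 : 0 ≤ ρ := by rw [hρ]; exact div_nonneg (by linarith) hB'.le
  have hV' : (1 - ρ) * (U / B) = U / B' := by rw [hρ]; field_simp; ring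
  obtain ⟨hs1, hs2⟩ := cutoffSlope_mul_le hρ0 hV (div_nonneg hU hB.le)
  rw [hV'] at hs1 hs2
  set a := cutoff (U / B')
  set s := cutoffSlope (U / B')
  have ha : 0 ≤ a := cutoff_nonneg _
  have hs : 0 ≤ s := cutoffSlope_nonneg _
  set f : ι → ℝ := fun k => cutoff ((U + (y₁ k + y₂ k)) / B') with hf
  have hfa : ∀ k, f k ≤ a := fun k => antitone_cutoff (by
    gcongr
    linarith [hy₁ k, hy₂ k])
  have hf0 : ∀ k, 0 ≤ f k := fun k => cutoff_nonneg _
  have hEf : a - s * (ρ / 32) - 4 * a * h ≤ ∑ k, p k * f k := by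
    have h1 : ∀ k, p k * a - s * (p k * (y₁ k + y₂ k) / B')
        - 4 * a * (p k * ((y₁ k / B') ^ 2 + y₂ k / B')) ≤ p k * f k := fun k => by
      have := cutoff_add_ge (U / B') (div_nonneg (hy₁ k) hB'.le) (div_nonneg (hy₂ k) hB'.le)
      have e1 : U / B' + (y₁ k / B' + y₂ k / B') = (U + (y₁ k + y₂ k)) / B' := by ring
      rw [e1] at this
      calc _ = p k * (a - s * (y₁ k / B' + y₂ k / B')
            - 4 * a * ((y₁ k / B') ^ 2 + y₂ k / B')) := by ring
        _ ≤ _ := mul_le_mul_of_nonneg_left this (hp k)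
    have h2 := Finset.sum_le_sum fun k (_ : k ∈ Finset.univ) => h1 k
    rw [Finset.sum_sub_distrib, Finset.sum_sub_distrib, ← Finset.sum_mul, hp1, ← Finset.mul_sum,
      ← Finset.mul_sum, ← Finset.sum_div] at h2
    refine le_trans ?_ h2
    have h3 : (∑ k, p k * (y₁ k + y₂ k)) / B' ≤ ρ / 32 := by
      rw [hρ, div_le_iff₀ hB']
      calc _ ≤ _ := hmean
        _ = _ := by field_simp
    nlinarith
  have hgap : a - ∑ k, p k * f k ≤ a / 8 := by nlinarith
  have hmain : Real.exp (-(16 * h)) * cutoff (U / B) ≤ ∑ k, p k * f k := by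
    have h1 : Real.exp (-(16 * h)) ≤ 1 - 8 * h := by
      have := exp_neg_le_quadratic (by positivity : 0 ≤ 16 * h)
      nlinarith
    have h2 : (1 - 8 * h) * cutoff (U / B) ≤ (1 - 8 * h) * (a - s * (ρ / 32)) :=
      mul_le_mul_of_nonneg_left hs2 (by linarith)
    have h3 := mul_le_mul_of_nonneg_right h1 (cutoff_nonneg (U / B))
    nlinarith
  have hterm : ∀ k, p k * f k * (1 - Ψ) + Ψ * (p k * a * (1 - Real.exp (x k - 2 * e))
      - (p k * a - p k * f k) * (1 - Real.exp (-(2 * e)))) ≤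
      p k * (f k * max (1 - Ψ * Real.exp (x k - 2 * e)) 0) := fun k => by
    have h1 : f k * (1 - Ψ * Real.exp (x k - 2 * e)) ≤
        f k * max (1 - Ψ * Real.exp (x k - 2 * e)) 0 :=
      mul_le_mul_of_nonneg_left (le_max_left _ _) (hf0 k)
    have h2 : Real.exp (-(2 * e)) ≤ Real.exp (x k - 2 * e) :=
      Real.exp_le_exp.2 (by linarith [hx0 k])
    have h3 := mul_nonneg hΨ (mul_nonneg (sub_nonneg.2 (hfa k)) (sub_nonneg.2 h2))
    calc _ = p k * (f k * (1 - Ψ) + Ψ * (a * (1 - Real.exp (x k - 2 * e))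
          - (a - f k) * (1 - Real.exp (-(2 * e))))) := by ring
      _ ≤ _ := mul_le_mul_of_nonneg_left (by nlinarith) (hp k)
  have hsum := Finset.sum_le_sum fun k (_ : k ∈ Finset.univ) => hterm k
  rw [Finset.sum_add_distrib, ← Finset.sum_mul, ← Finset.mul_sum, Finset.sum_sub_distrib,
    ← Finset.sum_mul, Finset.sum_sub_distrib] at hsum
  refine le_trans ?_ hsum
  have hX : 7 / 8 * Real.exp (-(2 * e)) + ∑ k, p k * Real.exp (x k - 2 * e) ≤
      7 / 8 + Real.exp (-(2 * e)) := by
    have h1 : ∀ k, p k * Real.exp (x k - 2 * e) ≤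
        Real.exp (-(2 * e)) * (p k + 7 / 4 * (p k * x k)) := fun k => by
      have := exp_le_one_add_mul_of_le_one (hx0 k) (hx1 k)
      rw [sub_eq_add_neg, Real.exp_add]
      have h5 := mul_le_mul_of_nonneg_left this (mul_nonneg (hp k) (Real.exp_pos (-(2 * e))).le)
      linarith
    have h2 := Finset.sum_le_sum fun k (_ : k ∈ Finset.univ) => h1 k
    rw [← Finset.mul_sum, Finset.sum_add_distrib, hp1, ← Finset.mul_sum] at h2
    have h3 : Real.exp (-(2 * e)) * (1 + 2 * e) ≤ 1 := by
      have := Real.add_one_le_exp (2 * e)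
      calc _ ≤ Real.exp (-(2 * e)) * Real.exp (2 * e) := by gcongr; linarith
        _ = 1 := by rw [← Real.exp_add]; simp
    have h4 := mul_le_mul_of_nonneg_left hxm (Real.exp_pos (-(2 * e))).le
    nlinarith
  have hX2 : ∑ k, p k * a * (1 - Real.exp (x k - 2 * e)) =
      a * (1 - ∑ k, p k * Real.exp (x k - 2 * e)) := by
    conv_rhs => rw [← hp1, ← Finset.sum_sub_distrib, Finset.mul_sum]
    exact Finset.sum_congr rfl fun k _ => by ring
  have hpa : ∑ k, p k * a = a := by rw [← Finset.sum_mul, hp1, one_mul]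
  rw [hX2, hpa]
  have hE1 : 0 ≤ 1 - Real.exp (-(2 * e)) := by
    rw [sub_nonneg, Real.exp_le_one_iff]; linarith
  have hpos : 0 ≤ a * (1 - ∑ k, p k * Real.exp (x k - 2 * e))
      - (a - ∑ k, p k * f k) * (1 - Real.exp (-(2 * e))) := by
    nlinarith [mul_le_mul_of_nonneg_right hgap hE1]
  nlinarith [mul_nonneg hΨ hpos]

section Sampling

variable {Ω ι : Type*} [Fintype ι] [MeasurableSpace ι] [MeasurableSingletonClass ι]

theorem measurable_comp_action {m : MeasurableSpace Ω} {I : Ω → ι} (hI : Measurable[m] I)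
    {g : Ω → ι → ℝ} (hg : ∀ k, Measurable[m] fun ω => g ω k) :
    Measurable[m] fun ω => g ω (I ω) := by
  classical
  have h : (fun ω => g ω (I ω)) =
      fun ω => ∑ k, Set.indicator (I ⁻¹' {k}) (fun ω => g ω k) ω := by
    ext ω
    rw [Finset.sum_eq_single (I ω)]
    · simp
    · intro k _ hk
      simp [Ne.symm hk]
    · simp
  rw [h]
  exact Finset.measurable_sum _ fun k _ => (hg k).indicator (hI (measurableSet_singleton k))

/-- Integrating a predictable function of the sampled action amounts to averaging it against
the conditional law of the action. -/
theorem integral_comp_action {m mΩ : MeasurableSpace Ω} {μ : Measure Ω} [IsProbabilityMeasure μ]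
    (hm : m ≤ mΩ) {I : Ω → ι} (hI : Measurable[mΩ] I) {p : Ω → ι → ℝ}
    (hlaw : ∀ i, (μ[fun ω => Set.indicator {ω' | I ω' = i} (fun _ => (1 : ℝ)) ω | m])
      =ᵐ[μ] fun ω => p ω i)
    {g : Ω → ι → ℝ} (hg : ∀ k, Measurable[m] fun ω => g ω k) {M : ℝ}
    (hM : ∀ ω k, |g ω k| ≤ M) :
    Integrable (fun ω => ∑ k, p ω k * g ω k) μ ∧
      ∫ ω, g ω (I ω) ∂μ = ∫ ω, ∑ k, p ω k * g ω k ∂μ := by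
  classical
  have hind : ∀ k, Integrable (fun ω => Set.indicator {ω' | I ω' = k} (fun _ => (1 : ℝ)) ω) μ :=
    fun k => (integrable_const (1 : ℝ)).indicator (hI (measurableSet_singleton k))
  have hgi : ∀ k, Integrable (fun ω => g ω k *
      Set.indicator {ω' | I ω' = k} (fun _ => (1 : ℝ)) ω) μ := fun k =>
    (hind k).bdd_mul (c := M) ((hg k).mono hm le_rfl).aestronglyMeasurable
      (Filter.Eventually.of_forall fun ω => hM ω k)
  have hce : ∀ k, μ[fun ω => g ω k * Set.indicator {ω' | I ω' = k} (fun _ => (1 : ℝ)) ω | m]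
      =ᵐ[μ] fun ω => p ω k * g ω k := fun k => by
    refine (condExp_mul_of_stronglyMeasurable_left (hg k).stronglyMeasurable (hgi k)
      (hind k)).trans ?_
    filter_upwards [hlaw k] with ω hω
    rw [Pi.mul_apply, hω, mul_comm]
  have hpi : ∀ k, Integrable (fun ω => p ω k * g ω k) μ := fun k =>
    integrable_condExp.congr (hce k)
  have h : (fun ω => g ω (I ω)) =
      fun ω => ∑ k, g ω k * Set.indicator {ω' | I ω' = k} (fun _ => (1 : ℝ)) ω := by
    ext ω
    rw [Finset.sum_eq_single (I ω)]
    · simp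
    · intro k _ hk
      simp [Ne.symm hk]
    · simp
  refine ⟨integrable_finsetSum _ fun k _ => hpi k, ?_⟩
  rw [h, integral_finsetSum _ fun k _ => hgi k, integral_finsetSum _ fun k _ => hpi k]
  refine Finset.sum_congr rfl fun k _ => ?_
  rw [← integral_condExp hm]
  exact integral_congr_ae (hce k)

/-- For `n < T`, the action `I n` is drawn from the distribution `p n` given the past `ℱ n`. -/
structure IsSampled {mΩ : MeasurableSpace Ω} (μ : Measure Ω) (ℱ : ℕ → MeasurableSpace Ω) (T : ℕ)
    (I : ℕ → Ω → ι) (p : ℕ → Ω → ι → ℝ) : Prop where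
  le : ∀ n, ℱ n ≤ mΩ
  mono : Monotone ℱ
  measurable : ∀ n < T, Measurable[ℱ (n + 1)] (I n)
  nonneg : ∀ n ω k, 0 ≤ p n ω k
  sum_eq_one : ∀ n ω, ∑ k, p n ω k = 1
  law : ∀ n < T, ∀ i, (μ[fun ω => Set.indicator {ω' | I n ω' = i} (fun _ => (1 : ℝ)) ω | ℱ n])
    =ᵐ[μ] fun ω => p n ω i

/-- Simultaneous control of a sum of heavy-tailed variables `y₁ + y₂` (through the predictable
scale `B` and the predictable budget `L` of relative fluctuations) and of a sum of bounded
variables `x` with predictable conditional means `e`. -/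
theorem exp_neg_mul_le_measureReal {mΩ : MeasurableSpace Ω} {μ : Measure Ω}
    [IsProbabilityMeasure μ] {ℱ : ℕ → MeasurableSpace Ω} {T : ℕ} {I : ℕ → Ω → ι}
    {p : ℕ → Ω → ι → ℝ} (hS : IsSampled μ ℱ T I p)
    {y₁ y₂ x : ℕ → Ω → ι → ℝ} {B L e : ℕ → Ω → ℝ}
    (hmy₁ : ∀ n < T, ∀ k, Measurable[ℱ n] fun ω => y₁ n ω k)
    (hmy₂ : ∀ n < T, ∀ k, Measurable[ℱ n] fun ω => y₂ n ω k)
    (hmx : ∀ n < T, ∀ k, Measurable[ℱ n] fun ω => x n ω k)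
    (hmB : ∀ n < T, Measurable[ℱ n] (B (n + 1))) (hmL : ∀ n < T, Measurable[ℱ n] (L (n + 1)))
    (hme : ∀ n < T, Measurable[ℱ n] (e n))
    (hy₁ : ∀ n ω k, 0 ≤ y₁ n ω k) (hy₂ : ∀ n ω k, 0 ≤ y₂ n ω k) (hx0 : ∀ n ω k, 0 ≤ x n ω k)
    (hx1 : ∀ n < T, ∀ ω k, x n ω k ≤ 1) {b : ℝ} (hb : 0 < b) (hB0 : ∀ ω, B 0 ω = b)
    (hL0 : ∀ ω, L 0 ω = 0)
    (hBmono : ∀ n < T, ∀ ω, B n ω ≤ B (n + 1) ω)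
    (hmean : ∀ n < T, ∀ ω,
      ∑ k, p n ω k * (y₁ n ω k + y₂ n ω k) ≤ (B (n + 1) ω - B n ω) / 32)
    (hvar : ∀ n < T, ∀ ω, ∑ k, p n ω k * ((y₁ n ω k / B (n + 1) ω) ^ 2 +
      y₂ n ω k / B (n + 1) ω) ≤ (L (n + 1) ω - L n ω) / 16)
    (hvar' : ∀ n < T, ∀ ω, ∑ k, p n ω k * ((y₁ n ω k / B (n + 1) ω) ^ 2 +
      y₂ n ω k / B (n + 1) ω) ≤ 1 / 64)
    (hxm : ∀ n < T, ∀ ω, ∑ k, p n ω k * x n ω k ≤ e n ω) {c : ℝ}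
    (hLc : ∀ n ≤ T, ∀ ω, L n ω ≤ c) (a : ℝ) :
    Real.exp (-c) * (1 - Real.exp (-a)) ≤ μ.real {ω |
      ∑ n ∈ Finset.range T, (y₁ n ω (I n ω) + y₂ n ω (I n ω)) ≤ 2 * B T ω ∧
      ∑ n ∈ Finset.range T, x n ω (I n ω) ≤ 2 * ∑ n ∈ Finset.range T, e n ω + a} := by
  obtain ⟨hle, hmono, hI, hp, hp1, hlaw⟩ := hS
  set U : ℕ → Ω → ℝ := fun n ω =>
    ∑ s ∈ Finset.range n, (y₁ s ω (I s ω) + y₂ s ω (I s ω)) with hU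
  set P : ℕ → Ω → ℝ := fun n ω =>
    Real.exp (∑ s ∈ Finset.range n, (x s ω (I s ω) - 2 * e s ω) - a) with hP
  set F : ℕ → Ω → ℝ := fun n ω =>
    cutoff (U n ω / B n ω) * max (1 - P n ω) 0 * Real.exp (L n ω) with hF
  have hBpos : ∀ n ≤ T, ∀ ω, 0 < B n ω := by
    intro n
    induction n with
    | zero => exact fun _ ω => by rw [hB0]; exact hb
    | succ n ih => exact fun hn ω => (ih (by omega) ω).trans_le (hBmono n hn ω)
  have hU0 : ∀ n ω, 0 ≤ U n ω := fun n ω =>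
    Finset.sum_nonneg fun s _ => add_nonneg (hy₁ _ _ _) (hy₂ _ _ _)
  have hmU : ∀ n ≤ T, Measurable[ℱ n] (U n) := fun n hn =>
    Finset.measurable_sum _ fun s hs => by
      have hs' := Finset.mem_range.1 hs
      exact Measurable.mono (measurable_comp_action (hI s (by omega)) fun k =>
        (((hmy₁ s (by omega) k).add (hmy₂ s (by omega) k)).mono (hmono (Nat.le_succ s)) le_rfl))
        (hmono hs') le_rfl
  have hmP : ∀ n ≤ T, Measurable[ℱ n] (P n) := fun n hn =>
    Real.measurable_exp.comp (Measurable.sub_const (Finset.measurable_sum _ fun s hs => by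
      have hs' := Finset.mem_range.1 hs
      exact Measurable.mono (measurable_comp_action (g := fun ω k => x s ω k - 2 * e s ω)
        (hI s (by omega)) fun k =>
        (((hmx s (by omega) k).sub ((hme s (by omega)).const_mul 2)).mono
          (hmono (Nat.le_succ s)) le_rfl)) (hmono hs') le_rfl) a)
  have hgM : ∀ (u v l : ℝ), 0 ≤ v → l ≤ c →
      0 ≤ cutoff u * max (1 - v) 0 * Real.exp l ∧
      cutoff u * max (1 - v) 0 * Real.exp l ≤ Real.exp c := fun u v l hv hl => by
    refine ⟨by have := cutoff_nonneg u; positivity, ?_⟩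
    calc _ ≤ 1 * 1 * Real.exp c := by
          have := cutoff_nonneg u
          have := cutoff_le_one u
          gcongr
          exact max_le (by linarith) zero_le_one
      _ = _ := by ring
  have hstep : ∀ n ≤ T, 1 - Real.exp (-a) ≤ ∫ ω, F n ω ∂μ := by
    intro n
    induction n with
    | zero =>
      intro _
      simp [hF, hU, hP, hL0, cutoff_of_le_one]
    | succ n ih =>
      intro hn
      refine (ih (by omega)).trans ?_
      set g : Ω → ι → ℝ := fun ω k =>
        cutoff ((U n ω + (y₁ n ω k + y₂ n ω k)) / B (n + 1) ω) *
          max (1 - P n ω * Real.exp (x n ω k - 2 * e n ω)) 0 * Real.exp (L (n + 1) ω) with hg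
      have hFg : ∀ ω, F (n + 1) ω = g ω (I n ω) := fun ω => by
        simp only [hF, hg, hU, hP]
        rw [Finset.sum_range_succ, Finset.sum_range_succ, ← Real.exp_add]
        congr 5
        ring
      have hmg : ∀ k, Measurable[ℱ n] fun ω => g ω k := fun k => by
        have h1 := hmU n (by omega)
        have h2 := hmP n (by omega)
        have h3 := hmy₁ n hn k
        have h4 := hmy₂ n hn k
        have h5 := hmx n hn k
        have h6 := hmB n hn
        have h7 := hmL n hn
        have h8 := hme n hn
        exact ((measurable_cutoff.comp ((h1.add (h3.add h4)).div h6)).mul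
          ((measurable_const.sub (h2.mul (Real.measurable_exp.comp
            (h5.sub (h8.const_mul 2))))).max measurable_const)).mul (Real.measurable_exp.comp h7)
      have hgb : ∀ ω k, |g ω k| ≤ Real.exp c := fun ω k => by
        have := hgM ((U n ω + (y₁ n ω k + y₂ n ω k)) / B (n + 1) ω)
          (P n ω * Real.exp (x n ω k - 2 * e n ω)) (L (n + 1) ω) (by positivity)
          (hLc _ hn ω)
        rw [abs_of_nonneg this.1]
        exact this.2
      simp only [hFg]
      obtain ⟨hint, heq⟩ := integral_comp_action (hle n) ((hI n hn).mono (hle _) le_rfl)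
        (hlaw n hn) hmg hgb
      rw [heq]
      refine integral_mono_of_nonneg (Filter.Eventually.of_forall fun ω =>
        (hgM _ _ _ (Real.exp_pos _).le (hLc n (by omega) ω)).1) hint
        (Filter.Eventually.of_forall fun ω => ?_)
      have := potential_step (p n ω) (y₁ n ω) (y₂ n ω) (x n ω) (hp n ω) (hp1 n ω) (hy₁ n ω)
          (hy₂ n ω) (hx0 n ω) (hx1 n hn ω) (hU0 n ω) (hBpos n (by omega) ω) (hBmono n hn ω)
          (hmean n hn ω) le_rfl (hvar' n hn ω) (hxm n hn ω) (Real.exp_pos _).le (Ψ := P n ω)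
      have h16 := hvar n hn ω
      have h0 : 0 ≤ cutoff (U n ω / B n ω) * max (1 - P n ω) 0 :=
        mul_nonneg (cutoff_nonneg _) (le_max_right _ _)
      calc F n ω ≤ cutoff (U n ω / B n ω) * max (1 - P n ω) 0 * (Real.exp (L (n + 1) ω) *
            Real.exp (-(16 * ∑ k, p n ω k * ((y₁ n ω k / B (n + 1) ω) ^ 2 +
              y₂ n ω k / B (n + 1) ω)))) := by
            rw [← Real.exp_add]
            exact mul_le_mul_of_nonneg_left (Real.exp_le_exp.2 (by linarith)) h0
        _ ≤ Real.exp (L (n + 1) ω) * ∑ k, p n ω k *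
            (cutoff ((U n ω + (y₁ n ω k + y₂ n ω k)) / B (n + 1) ω) *
              max (1 - P n ω * Real.exp (x n ω k - 2 * e n ω)) 0) := by
            have h1 := mul_le_mul_of_nonneg_left this (Real.exp_pos (L (n + 1) ω)).le
            linarith
        _ = ∑ k, p n ω k * g ω k := by
            rw [Finset.mul_sum]
            exact Finset.sum_congr rfl fun k _ => by simp only [hg]; ring
  have hmB' : Measurable (B T) := by
    rcases T with _ | n
    · rw [show B 0 = fun _ => b from funext hB0]
      exact measurable_const
    · exact (hmB n (by omega)).mono (hle _) le_rfl
  have hmL' : Measurable (L T) := by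
    rcases T with _ | n
    · rw [show L 0 = fun _ => 0 from funext hL0]
      exact measurable_const
    · exact (hmL n (by omega)).mono (hle _) le_rfl
  have hmF : Measurable (F T) :=
    ((measurable_cutoff.comp (((hmU T le_rfl).mono (hle _) le_rfl).div hmB')).mul
      ((measurable_const.sub ((hmP T le_rfl).mono (hle _) le_rfl)).max measurable_const)).mul
      (Real.measurable_exp.comp hmL')
  have hmS : MeasurableSet {ω | 0 < F T ω} := measurableSet_lt measurable_const hmF
  have hbound : ∫ ω, F T ω ∂μ ≤ Real.exp c * μ.real {ω | 0 < F T ω} := by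
    have h1 : ∀ ω, F T ω ≤ Set.indicator {ω | 0 < F T ω} (fun _ => Real.exp c) ω := fun ω => by
      by_cases hω : 0 < F T ω
      · rw [Set.indicator_of_mem (by exact hω)]
        exact (hgM _ _ _ (Real.exp_pos _).le (hLc T le_rfl ω)).2
      · rw [Set.indicator_of_notMem (by exact hω)]
        exact not_lt.1 hω
    refine (integral_mono_of_nonneg (Filter.Eventually.of_forall fun ω =>
      (hgM _ _ _ (Real.exp_pos _).le (hLc T le_rfl ω)).1)
      ((integrable_const (Real.exp c)).indicator hmS) (Filter.Eventually.of_forall h1)).trans ?_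
    rw [integral_indicator_const _ hmS, smul_eq_mul, mul_comm]
  have hsub : {ω | 0 < F T ω} ⊆ {ω |
      ∑ n ∈ Finset.range T, (y₁ n ω (I n ω) + y₂ n ω (I n ω)) ≤ 2 * B T ω ∧
      ∑ n ∈ Finset.range T, x n ω (I n ω) ≤ 2 * ∑ n ∈ Finset.range T, e n ω + a} := by
    intro ω hω
    have hω' : 0 < F T ω := hω
    constructor
    · by_contra! hlt
      have : cutoff (U T ω / B T ω) = 0 := cutoff_of_two_le (by
        rw [le_div_iff₀ (hBpos T le_rfl ω)]
        exact hlt.le)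
      simp [hF, this] at hω'
    · by_contra! hlt
      have : max (1 - P T ω) 0 = 0 := max_eq_right (by
        simp only [hP, Finset.sum_sub_distrib, ← Finset.mul_sum]
        have := Real.one_le_exp (x := ∑ n ∈ Finset.range T, x n ω (I n ω) -
          2 * ∑ n ∈ Finset.range T, e n ω - a) (by linarith)
        linarith)
      simp [hF, this] at hω'
  have hfin := (hstep T le_rfl).trans (hbound.trans
    (mul_le_mul_of_nonneg_left (measureReal_mono hsub) (Real.exp_pos c).le))
  calc _ ≤ Real.exp (-c) * (Real.exp c * _) :=
        mul_le_mul_of_nonneg_left hfin (Real.exp_pos _).le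
    _ = _ := by rw [← mul_assoc, ← Real.exp_add]; simp

/-- A one-sided Freedman-type inequality for variables in `[0, 1]`. -/
theorem measureReal_lt_sum_le_exp_neg {mΩ : MeasurableSpace Ω} {μ : Measure Ω}
    [IsProbabilityMeasure μ] {ℱ : ℕ → MeasurableSpace Ω} {T : ℕ} {I : ℕ → Ω → ι}
    {p : ℕ → Ω → ι → ℝ} (hS : IsSampled μ ℱ T I p)
    {x : ℕ → Ω → ι → ℝ} {e : ℕ → Ω → ℝ}
    (hmx : ∀ n < T, ∀ k, Measurable[ℱ n] fun ω => x n ω k)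
    (hme : ∀ n < T, Measurable[ℱ n] (e n)) (hx0 : ∀ n ω k, 0 ≤ x n ω k)
    (hx1 : ∀ n < T, ∀ ω k, x n ω k ≤ 1)
    (hxm : ∀ n < T, ∀ ω, ∑ k, p n ω k * x n ω k ≤ e n ω) (a : ℝ) :
    μ.real {ω | 2 * ∑ n ∈ Finset.range T, e n ω + a < ∑ n ∈ Finset.range T, x n ω (I n ω)} ≤
      Real.exp (-a) := by
  have h := exp_neg_mul_le_measureReal hS (y₁ := fun _ _ _ => 0)
    (y₂ := fun _ _ _ => 0) (x := x) (B := fun _ _ => 1) (L := fun _ _ => 0) (e := e)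
    (fun _ _ _ => measurable_const) (fun _ _ _ => measurable_const) hmx
    (fun _ _ => measurable_const) (fun _ _ => measurable_const) hme (fun _ _ _ => le_rfl)
    (fun _ _ _ => le_rfl) hx0 hx1 one_pos (fun _ => rfl) (fun _ => rfl) (fun _ _ _ => le_rfl)
    (by simp) (by simp) (by simp) hxm (c := 0) (fun _ _ _ => le_rfl) a
  have hm1 : Measurable fun ω => ∑ n ∈ Finset.range T, x n ω (I n ω) :=
    Finset.measurable_sum _ fun n hn => by
      have hn' := Finset.mem_range.1 hn
      exact measurable_comp_action ((hS.measurable n hn').mono (hS.le _) le_rfl)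
        fun k => (hmx n hn' k).mono (hS.le _) le_rfl
  have hm2 : Measurable fun ω => 2 * ∑ n ∈ Finset.range T, e n ω + a :=
    ((Finset.measurable_sum _ fun n hn =>
      (hme n (Finset.mem_range.1 hn)).mono (hS.le _) le_rfl).const_mul 2).add_const a
  have hc := probReal_compl_eq_one_sub (μ := μ) (measurableSet_le hm1 hm2)
  have hset : {ω | ∑ n ∈ Finset.range T, x n ω (I n ω) ≤
      2 * ∑ n ∈ Finset.range T, e n ω + a}ᶜ =
      {ω | 2 * ∑ n ∈ Finset.range T, e n ω + a < ∑ n ∈ Finset.range T, x n ω (I n ω)} := by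
    ext ω
    simp
  rw [hset] at hc
  rw [hc]
  simp only [Finset.sum_const_zero, add_zero, mul_one, Nat.ofNat_nonneg, true_and, neg_zero,
    Real.exp_zero, one_mul] at h
  linarith

end Sampling

section Regimes

variable {Ω ι : Type*} [Fintype ι] [MeasurableSpace ι] [MeasurableSingletonClass ι]
  {mΩ : MeasurableSpace Ω} {μ : Measure Ω} [IsProbabilityMeasure μ] {ℱ : ℕ → MeasurableSpace Ω}
  {T : ℕ} {I : ℕ → Ω → ι} {p : ℕ → Ω → ι → ℝ}

/-- Deviation bound for losses `y₁ + y₂` whose mean is of order `α L` and whose part `y₁` is at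
most of order `α κ / γ`, on an event of probability `κ` only. -/
theorem le_measureReal_of_truncated (hS : IsSampled μ ℱ T I p)
    {y₁ y₂ x : ℕ → Ω → ι → ℝ} {α : ℕ → Ω → ℝ}
    (hmy₁ : ∀ n < T, ∀ k, Measurable[ℱ n] fun ω => y₁ n ω k)
    (hmy₂ : ∀ n < T, ∀ k, Measurable[ℱ n] fun ω => y₂ n ω k)
    (hmx : ∀ n < T, ∀ k, Measurable[ℱ n] fun ω => x n ω k)
    (hmα : ∀ n < T, Measurable[ℱ n] (α n))
    (hy₁ : ∀ n ω k, 0 ≤ y₁ n ω k) (hy₂ : ∀ n ω k, 0 ≤ y₂ n ω k) (hx0 : ∀ n ω k, 0 ≤ x n ω k)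
    (hx1 : ∀ n < T, ∀ ω k, x n ω k ≤ 1) {ε : ℝ}
    (hxm : ∀ n < T, ∀ ω, ∑ k, p n ω k * x n ω k ≤ ε)
    {γ κ L : ℝ} (hγ : 0 < γ) (hκ : 0 < κ) (hκ2 : κ ≤ 1 / 2) (hL1 : 1 ≤ L)
    (hα : ∀ n ω, α n ω = 0 ∨ 1 ≤ α n ω)
    (hαL : ∀ ω, Real.log (1 + ∑ n ∈ Finset.range T, α n ω) ≤ L)
    (hy₁b : ∀ n < T, ∀ ω k, y₁ n ω k ≤ 8 * α n ω * κ / γ)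
    (hmean : ∀ n < T, ∀ ω, ∑ k, p n ω k * (y₁ n ω k + y₂ n ω k) ≤ 2 * α n ω * L)
    (hmean₂ : ∀ n < T, ∀ ω, ∑ k, p n ω k * y₂ n ω k ≤ 4 * α n ω * Real.log (1 / κ)) :
    κ ≤ μ.real {ω |
      ∑ n ∈ Finset.range T, x n ω (I n ω) ≤ 2 * T * ε + 2 * Real.log 2 ∧
      ∀ R, 0 ≤ R → (∀ n < T, α n ω ≤ R) →
        ∑ n ∈ Finset.range T, (y₁ n ω (I n ω) + y₂ n ω (I n ω)) ≤
          640 * L * (∑ n ∈ Finset.range T, α n ω + κ * R / γ) + 1 / 2} := by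
  have hα0 : ∀ n ω, 0 ≤ α n ω := fun n ω => by rcases hα n ω with h | h <;> linarith
  set A : ℕ → Ω → ℝ := fun n ω => ∑ s ∈ Finset.range n, α s ω with hA
  set M : ℕ → Ω → ℝ := fun n ω => (Finset.range n).fold max 0 (fun s => α s ω) with hM
  have hA0 : ∀ n ω, 0 ≤ A n ω := fun n ω => Finset.sum_nonneg fun s _ => hα0 s ω
  have hAs : ∀ n ω, A (n + 1) ω = A n ω + α n ω := fun n ω => Finset.sum_range_succ _ _
  have hMs : ∀ n ω, M (n + 1) ω = max (α n ω) (M n ω) := fun n ω => by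
    simp only [hM]
    rw [Finset.range_add_one, Finset.fold_insert Finset.notMem_range_self]
  have hM0 : ∀ n ω, 0 ≤ M n ω := fun n ω => Finset.le_fold_max 0 |>.2 (Or.inl le_rfl)
  have hAmono : ∀ m n, m ≤ n → ∀ ω, A m ω ≤ A n ω := fun m n h ω =>
    Finset.sum_le_sum_of_subset_of_nonneg (Finset.range_mono h) fun s _ _ => hα0 s ω
  have hmA : ∀ n < T, Measurable[ℱ n] (A (n + 1)) := fun n hn =>
    Finset.measurable_sum _ fun s hs => (hmα s (by have := Finset.mem_range.1 hs; omega)).mono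
      (hS.mono (by have := Finset.mem_range.1 hs; omega)) le_rfl
  have hmM : ∀ n < T, Measurable[ℱ n] (M (n + 1)) := fun n => by
    induction n with
    | zero =>
      intro hn
      rw [show M 1 = fun ω => max (α 0 ω) 0 from funext fun ω => hMs 0 ω]
      exact (hmα 0 hn).max measurable_const
    | succ n ih =>
      intro hn
      rw [show M (n + 1 + 1) = fun ω => max (α (n + 1) ω) (M (n + 1) ω) from
        funext fun ω => hMs _ ω]
      exact (hmα _ hn).max ((ih (by omega)).mono (hS.mono (Nat.le_succ n)) le_rfl)
  set s := Real.log (1 / κ) with hs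
  have hs2 : 1 / 2 ≤ s := by
    have h1 : Real.log 2 ≤ s := Real.log_le_log (by norm_num) (by
      rw [le_div_iff₀ hκ]; linarith)
    have := Real.log_two_gt_d9
    linarith
  set B : ℕ → Ω → ℝ := fun n ω => 320 * L * (A n ω + κ * M n ω / γ) + 1 / 4 with hB
  set Λ : ℕ → Ω → ℝ := fun n ω => s / (2 * L) * Real.log (1 + A n ω) with hΛ
  have hL0 : 0 < L := by linarith
  have hBstep : ∀ n ω, 320 * L * α n ω ≤ B (n + 1) ω - B n ω := fun n ω => by
    have h1 : M n ω ≤ M (n + 1) ω := by rw [hMs]; exact le_max_right _ _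
    have h2 : κ * M n ω / γ ≤ κ * M (n + 1) ω / γ := by gcongr
    simp only [hB, hAs]
    nlinarith
  have hBA : ∀ n ω, 320 * L * A (n + 1) ω ≤ B (n + 1) ω := fun n ω => by
    have : 0 ≤ κ * M (n + 1) ω / γ := div_nonneg (mul_nonneg hκ.le (hM0 _ _)) hγ.le
    simp only [hB]
    nlinarith
  have hBα : ∀ n ω, 320 * L * (κ * α n ω / γ) ≤ B (n + 1) ω := fun n ω => by
    have h1 : α n ω ≤ M (n + 1) ω := by rw [hMs]; exact le_max_left _ _
    have h2 : κ * α n ω / γ ≤ κ * M (n + 1) ω / γ := by gcongr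
    have := hA0 (n + 1) ω
    simp only [hB]
    nlinarith
  have hBpos : ∀ n ω, 0 < B n ω := fun n ω => by
    have : 0 ≤ κ * M n ω / γ := div_nonneg (mul_nonneg hκ.le (hM0 _ _)) hγ.le
    have := hA0 n ω
    simp only [hB]
    positivity
  have hvar : ∀ n < T, ∀ ω, ∑ k, p n ω k * ((y₁ n ω k / B (n + 1) ω) ^ 2 +
      y₂ n ω k / B (n + 1) ω) ≤ α n ω / B (n + 1) ω * (1 / 20) +
        min (4 * α n ω * s) (2 * α n ω * L) / B (n + 1) ω := fun n hn ω => by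
    have hb := hBpos (n + 1) ω
    have h1 : ∀ k, p n ω k * ((y₁ n ω k / B (n + 1) ω) ^ 2 + y₂ n ω k / B (n + 1) ω) ≤
        (p n ω k * (y₁ n ω k + y₂ n ω k)) * (1 / (40 * L * B (n + 1) ω)) +
          p n ω k * y₂ n ω k * (1 / B (n + 1) ω) := fun k => by
      have h2 : y₁ n ω k / B (n + 1) ω ≤ 1 / (40 * L) := by
        rw [div_le_div_iff₀ hb (by positivity)]
        have h3 := hy₁b n hn ω k
        have h4 := hBα n ω
        have h5 : y₁ n ω k * (40 * L) ≤ 8 * α n ω * κ / γ * (40 * L) := by gcongr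
        calc _ ≤ _ := h5
          _ = 320 * L * (κ * α n ω / γ) := by ring
          _ ≤ _ := by linarith
      have h3 : (y₁ n ω k / B (n + 1) ω) ^ 2 ≤
          (y₁ n ω k + y₂ n ω k) * (1 / (40 * L * B (n + 1) ω)) := by
        have h4 : 0 ≤ y₁ n ω k / B (n + 1) ω := div_nonneg (hy₁ _ _ _) hb.le
        calc _ ≤ y₁ n ω k / B (n + 1) ω * (1 / (40 * L)) := by
              rw [sq]; exact mul_le_mul_of_nonneg_left h2 h4
          _ = y₁ n ω k * (1 / (40 * L * B (n + 1) ω)) := by field_simp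
          _ ≤ _ := by gcongr; linarith [hy₂ n ω k]
      have h5 := mul_le_mul_of_nonneg_left h3 (hS.nonneg n ω k)
      calc _ = p n ω k * (y₁ n ω k / B (n + 1) ω) ^ 2 + p n ω k * y₂ n ω k * (1 / B (n + 1) ω) := by
            ring
        _ ≤ _ := by linarith
    refine (Finset.sum_le_sum fun k _ => h1 k).trans ?_
    rw [Finset.sum_add_distrib, ← Finset.sum_mul, ← Finset.sum_mul]
    have h6 : ∑ k, p n ω k * y₂ n ω k ≤ min (4 * α n ω * s) (2 * α n ω * L) := by
      refine le_min (hmean₂ n hn ω) ((Finset.sum_le_sum fun k _ => ?_).trans (hmean n hn ω))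
      exact mul_le_mul_of_nonneg_left (by linarith [hy₁ n ω k]) (hS.nonneg n ω k)
    have h7 : (∑ k, p n ω k * (y₁ n ω k + y₂ n ω k)) * (1 / (40 * L * B (n + 1) ω)) ≤
        2 * α n ω * L * (1 / (40 * L * B (n + 1) ω)) := by
      gcongr
      exact hmean n hn ω
    have h8 : 2 * α n ω * L * (1 / (40 * L * B (n + 1) ω)) = α n ω / B (n + 1) ω * (1 / 20) := by
      field_simp
      ring
    rw [h8] at h7
    have h9 : (∑ k, p n ω k * y₂ n ω k) * (1 / B (n + 1) ω) ≤
        min (4 * α n ω * s) (2 * α n ω * L) * (1 / B (n + 1) ω) := by gcongr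
    rw [mul_one_div _ (B (n + 1) ω)] at h9
    rw [mul_one_div (min _ _)] at h9
    rw [mul_one_div _ (B (n + 1) ω)]
    linarith
  have hmain := exp_neg_mul_le_measureReal hS (e := fun _ _ => ε) (B := B) (L := Λ) hmy₁ hmy₂ hmx
    (fun n hn => (((hmA n hn).add (((hmM n hn).const_mul κ).div_const γ)).const_mul _).add_const _)
    (fun n hn => (Real.measurable_log.comp (measurable_const.add (hmA n hn))).const_mul _)
    (fun _ _ => measurable_const) hy₁ hy₂ hx0 hx1 (by norm_num : (0 : ℝ) < 1 / 4)
    (fun ω => by simp [hB, hA, hM]) (fun ω => by simp [hΛ, hA])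
    (fun n _ ω => by
      have := hBstep n ω
      have := mul_nonneg hL0.le (hα0 n ω)
      linarith)
    (fun n hn ω => (hmean n hn ω).trans (by
      have := hBstep n ω
      have := mul_nonneg hL0.le (hα0 n ω)
      linarith))
    (fun n hn ω => (hvar n hn ω).trans (by
      rcases hα n ω with h | h
      · simp [h, hΛ, hAs]
      · have hA' : α n ω ≤ A (n + 1) ω := by linarith [hAs n ω, hA0 n ω]
        have hApos : 0 < A (n + 1) ω := by linarith
        have hb := hBpos (n + 1) ω
        have hlog : α n ω / (2 * A (n + 1) ω) ≤
            Real.log (1 + A (n + 1) ω) - Real.log (1 + A n ω) := by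
          have h0 := hA0 n ω
          rw [← Real.log_div (by linarith) (by linarith)]
          refine le_trans ?_ (Real.one_sub_inv_le_log_of_pos (by positivity))
          rw [inv_div, one_sub_div (by linarith), div_le_div_iff₀ (by linarith) (by linarith)]
          rw [hAs] at *
          nlinarith
        have hαB : α n ω / B (n + 1) ω ≤ α n ω / (320 * L * A (n + 1) ω) :=
          div_le_div_of_nonneg_left (hα0 n ω) (by positivity) (hBA n ω)
        calc _ ≤ α n ω / B (n + 1) ω * (1 / 20) + 4 * α n ω * s / B (n + 1) ω := by
              gcongr
              exact min_le_left _ _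
          _ = α n ω / B (n + 1) ω * (1 / 20 + 4 * s) := by ring
          _ ≤ α n ω / (320 * L * A (n + 1) ω) * (5 * s) := by gcongr; linarith
          _ = s / (2 * L) * (α n ω / (2 * A (n + 1) ω)) / 16 := by field_simp; norm_num
          _ ≤ s / (2 * L) * (Real.log (1 + A (n + 1) ω) - Real.log (1 + A n ω)) / 16 := by gcongr
          _ = _ := by simp only [hΛ]; ring))
    (fun n hn ω => (hvar n hn ω).trans (by
      have hb := hBpos (n + 1) ω
      have hαB : α n ω / B (n + 1) ω ≤ 1 / (320 * L) := by
        rw [div_le_div_iff₀ hb (by positivity)]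
        have := hBA n ω
        have := mul_nonneg hL0.le (hA0 n ω)
        rw [hAs] at *
        nlinarith
      calc _ ≤ α n ω / B (n + 1) ω * (1 / 20) + 2 * α n ω * L / B (n + 1) ω := by
            gcongr
            exact min_le_right _ _
        _ = α n ω / B (n + 1) ω * (1 / 20 + 2 * L) := by ring
        _ ≤ 1 / (320 * L) * (5 * L) := by gcongr; linarith
        _ = 1 / 64 := by field_simp; norm_num)) hxm (c := s / 2)
    (fun n hn ω => by
      have h1 : Real.log (1 + A n ω) ≤ L :=
        (Real.log_le_log (by linarith [hA0 n ω]) (by linarith [hAmono n T hn ω])).trans (hαL ω)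
      calc _ ≤ s / (2 * L) * L := by
            simp only [hΛ]; gcongr
        _ = _ := by field_simp) (2 * Real.log 2)
  have hprob : κ ≤ Real.exp (-(s / 2)) * (1 - Real.exp (-(2 * Real.log 2))) := by
    have h1 : Real.exp (-(2 * Real.log 2)) = 1 / 4 := by
      rw [Real.exp_neg, mul_comm, Real.exp_mul, Real.exp_log (by norm_num)]
      norm_num
    have h2 : Real.exp (-(s / 2)) ^ 2 = κ := by
      rw [← Real.exp_nat_mul, hs, one_div, Real.log_inv]
      push_cast
      rw [show 2 * -(-Real.log κ / 2) = Real.log κ by ring, Real.exp_log hκ]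
    rw [h1]
    have := Real.exp_pos (-(s / 2))
    nlinarith
  refine hprob.trans (hmain.trans (measureReal_mono ?_))
  rintro ω ⟨h1, h2⟩
  refine ⟨?_, fun R hR0 hR => h1.trans ?_⟩
  · simpa [mul_assoc] using h2
  · have h3 : M T ω ≤ R := Finset.fold_max_le R |>.2 ⟨hR0, fun n hn => hR n (Finset.mem_range.1 hn)⟩
    have h4 : κ * M T ω / γ ≤ κ * R / γ := by gcongr
    simp only [hB]
    nlinarith

/-- Deviation bound for losses `y` of size at most `2 α / γ` and mean at most `2 α l`, simultaneously
for all integral bounds `m ≤ N` on `α`. -/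
theorem one_sub_le_measureReal_of_le (hS : IsSampled μ ℱ T I p)
    {y x : ℕ → Ω → ι → ℝ} {α : ℕ → Ω → ℝ}
    (hmy : ∀ n < T, ∀ k, Measurable[ℱ n] fun ω => y n ω k)
    (hmx : ∀ n < T, ∀ k, Measurable[ℱ n] fun ω => x n ω k)
    (hmα : ∀ n < T, Measurable[ℱ n] (α n))
    (hy : ∀ n ω k, 0 ≤ y n ω k) (hx0 : ∀ n ω k, 0 ≤ x n ω k)
    (hx1 : ∀ n < T, ∀ ω k, x n ω k ≤ 1) {ε : ℝ}
    (hxm : ∀ n < T, ∀ ω, ∑ k, p n ω k * x n ω k ≤ ε)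
    {γ l δ : ℝ} (hγ : 0 < γ) (hl : 0 ≤ l) (hδ : 0 < δ) (hα : ∀ n ω, 0 ≤ α n ω)
    (hyb : ∀ n < T, ∀ ω k, y n ω k ≤ 2 * α n ω / γ)
    (hmean : ∀ n < T, ∀ ω, ∑ k, p n ω k * y n ω k ≤ 2 * α n ω * l) {N : ℕ} (hN : 0 < N) :
    1 - δ ≤ μ.real {ω |
      ∑ n ∈ Finset.range T, x n ω (I n ω) ≤ 2 * T * ε + Real.log (2 / δ) ∧
      ∀ m ∈ Finset.Icc 1 N, (∀ n < T, α n ω ≤ m) → ∑ n ∈ Finset.range T, y n ω (I n ω) ≤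
        4 * l * ∑ n ∈ Finset.range T, α n ω + 2 * m / γ * Real.log (2 * N / δ)} := by
  classical
  set G := {ω |
      ∑ n ∈ Finset.range T, x n ω (I n ω) ≤ 2 * T * ε + Real.log (2 / δ) ∧
      ∀ m ∈ Finset.Icc 1 N, (∀ n < T, α n ω ≤ m) → ∑ n ∈ Finset.range T, y n ω (I n ω) ≤
        4 * l * ∑ n ∈ Finset.range T, α n ω + 2 * m / γ * Real.log (2 * N / δ)} with hG
  have hX := measureReal_lt_sum_le_exp_neg hS hmx (fun _ _ => measurable_const) hx0 hx1 hxm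
    (Real.log (2 / δ))
  set z : ℕ → ℕ → Ω → ι → ℝ := fun m n ω k =>
    if α n ω ≤ m then y n ω k * (γ / (2 * m)) else 0 with hz
  set e : ℕ → ℕ → Ω → ℝ := fun m n ω => α n ω * (γ * l / m) with he
  have hY : ∀ m ∈ Finset.Icc 1 N, μ.real {ω | 2 * ∑ n ∈ Finset.range T, e m n ω +
      Real.log (2 * N / δ) < ∑ n ∈ Finset.range T, z m n ω (I n ω)} ≤
      Real.exp (-Real.log (2 * N / δ)) := fun m hm => by
    have hm0 : (0 : ℝ) < m := Nat.cast_pos.2 (by have := Finset.mem_Icc.1 hm; omega)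
    refine measureReal_lt_sum_le_exp_neg hS (fun n hn k => ?_) (fun n hn => (hmα n hn).mul_const _)
      (fun n ω k => ?_) (fun n hn ω k => ?_) (fun n hn ω => ?_) _
    · exact Measurable.ite (hmα n hn measurableSet_Iic)
        ((hmy n hn k).mul_const _) measurable_const
    · have := hy n ω k
      simp only [hz]
      split_ifs <;> positivity
    · simp only [hz]
      split_ifs with h
      · calc _ ≤ 2 * m / γ * (γ / (2 * m)) := by
              gcongr
              exact (hyb n hn ω k).trans (by gcongr)
          _ = 1 := by field_simp
      · exact zero_le_one
    · simp only [hz]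
      split_ifs with h
      · simp only [← mul_assoc]
        rw [← Finset.sum_mul]
        calc _ ≤ 2 * α n ω * l * (γ / (2 * m)) := by
              gcongr
              exact hmean n hn ω
          _ = _ := by field_simp
      · have := hα n ω
        simp only [mul_zero, Finset.sum_const_zero]
        positivity
  have hsub : Gᶜ ⊆ {ω | 2 * ∑ n ∈ Finset.range T, ε + Real.log (2 / δ) <
      ∑ n ∈ Finset.range T, x n ω (I n ω)} ∪ ⋃ m ∈ Finset.Icc 1 N,
      {ω | 2 * ∑ n ∈ Finset.range T, e m n ω + Real.log (2 * N / δ) <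
        ∑ n ∈ Finset.range T, z m n ω (I n ω)} := by
    intro ω hω
    by_contra hcon
    simp only [Set.mem_union, Set.mem_iUnion, Set.mem_ofPred_eq, not_or, not_exists, not_lt] at hcon
    refine hω ⟨by simpa [mul_assoc] using hcon.1, fun m hm hαm => ?_⟩
    have hm0 : (0 : ℝ) < m := Nat.cast_pos.2 (by have := Finset.mem_Icc.1 hm; omega)
    have h1 := hcon.2 m hm
    have h2 : ∑ n ∈ Finset.range T, z m n ω (I n ω) =
        (∑ n ∈ Finset.range T, y n ω (I n ω)) * (γ / (2 * m)) := by
      rw [Finset.sum_mul]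
      exact Finset.sum_congr rfl fun n hn => if_pos (hαm n (Finset.mem_range.1 hn))
    rw [h2, ← Finset.sum_mul, ← le_div_iff₀ (by positivity)] at h1
    refine h1.trans_eq ?_
    field_simp
    ring
  have hcompl : μ.real Gᶜ ≤ δ := by
    refine (measureReal_mono hsub).trans ((measureReal_union_le _ _).trans ?_)
    have h1 := (measureReal_biUnion_finset_le (μ := μ) (Finset.Icc 1 N) fun m =>
      {ω | 2 * ∑ n ∈ Finset.range T, e m n ω + Real.log (2 * N / δ) <
        ∑ n ∈ Finset.range T, z m n ω (I n ω)}).trans (Finset.sum_le_sum hY)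
    have h2 : ∑ m ∈ Finset.Icc 1 N, Real.exp (-Real.log (2 * N / δ)) = δ / 2 := by
      have : (0 : ℝ) < N := Nat.cast_pos.2 hN
      rw [Finset.sum_const, Nat.card_Icc, Real.exp_neg, Real.exp_log (by positivity), nsmul_eq_mul]
      simp only [Nat.add_sub_cancel]
      field_simp
    have h3 : Real.exp (-Real.log (2 / δ)) = δ / 2 := by
      rw [Real.exp_neg, Real.exp_log (by positivity), inv_div]
    linarith
  have h1 : (1 : ℝ) ≤ μ.real G + μ.real Gᶜ := by
    have := measureReal_union_le (μ := μ) G Gᶜ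
    rwa [Set.union_compl_self, probReal_univ] at this
  linarith

end Regimes

section SquaredEstimates

variable {ι : Type*} [DecidableEq ι]

/-- The contribution of the nodes of `D` to the second moment `∑ i, q i * ℓhat i ^ 2` of the
importance-weighted losses with denominators `d`, when the action `k` is played. -/
noncomputable def sqEstimate (D : Finset ι) (N : ι → Finset ι) (q ℓ d : ι → ℝ) (k : ι) : ℝ :=
  ∑ i ∈ D, if k ∈ N i then q i * (ℓ i / d i) ^ 2 else 0

theorem sqEstimate_nonneg (D : Finset ι) (N : ι → Finset ι) {q : ι → ℝ} (hq : ∀ i, 0 ≤ q i)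
    (ℓ d : ι → ℝ) (k : ι) : 0 ≤ sqEstimate D N q ℓ d k :=
  Finset.sum_nonneg fun i _ => by
    have := hq i
    split_ifs <;> positivity

theorem sqEstimate_filter_add_filter_not (D : Finset ι) (N : ι → Finset ι) (q ℓ d : ι → ℝ)
    (k : ι) (P : ι → Prop) [DecidablePred P] :
    sqEstimate (D.filter P) N q ℓ d k + sqEstimate (D.filter fun i => ¬ P i) N q ℓ d k =
      sqEstimate D N q ℓ d k :=
  Finset.sum_filter_add_sum_filter_not D P _

theorem sqEstimate_le (D : Finset ι) (N : ι → Finset ι) {q ℓ d : ι → ℝ} (hq : ∀ i, 0 ≤ q i)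
    (hℓ : ∀ i, ℓ i ∈ Set.Icc (0 : ℝ) 1) (k : ι) :
    sqEstimate D N q ℓ d k ≤ ∑ i ∈ D, q i / d i ^ 2 :=
  Finset.sum_le_sum fun i _ => by
    have h0 := hq i
    have h1 : ℓ i ^ 2 ≤ 1 := pow_le_one₀ (hℓ i).1 (hℓ i).2
    split_ifs
    · rw [div_pow, mul_div_assoc']
      gcongr
      exact mul_le_of_le_one_right h0 h1
    · positivity

theorem sum_mul_sqEstimate_le [Fintype ι] (D : Finset ι) (N : ι → Finset ι) {q ℓ d : ι → ℝ}
    (hq : ∀ i, 0 ≤ q i) (hℓ : ∀ i, ℓ i ∈ Set.Icc (0 : ℝ) 1) (hd : ∀ i ∈ D, 0 < d i)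
    (hW : ∀ i ∈ D, ∑ j ∈ N i, q j ≤ d i) :
    ∑ k, q k * sqEstimate D N q ℓ d k ≤ ∑ i ∈ D, q i / d i := by
  have h : ∑ k, q k * sqEstimate D N q ℓ d k =
      ∑ i ∈ D, (∑ j ∈ N i, q j) * (q i * (ℓ i / d i) ^ 2) := by
    simp only [sqEstimate, Finset.mul_sum]
    rw [Finset.sum_comm]
    refine Finset.sum_congr rfl fun i _ => ?_
    simp only [mul_ite, mul_zero]
    rw [← Finset.sum_filter, Finset.sum_mul]
    exact Finset.sum_congr (by ext; simp) fun _ _ => rfl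
  rw [h]
  refine Finset.sum_le_sum fun i hi => ?_
  have h0 := hq i
  have h1 : ℓ i ^ 2 ≤ 1 := pow_le_one₀ (hℓ i).1 (hℓ i).2
  have h2 := hd i hi
  calc _ ≤ d i * (q i * (1 / d i ^ 2)) := by
        rw [div_pow]
        gcongr
        exact hW i hi
    _ = _ := by field_simp

theorem measurable_sqEstimate {Ω : Type*} [Fintype ι] {m : MeasurableSpace Ω} {D : Ω → Finset ι}
    {N : Ω → ι → Finset ι} {q ℓ d : Ω → ι → ℝ} (hD : ∀ i, MeasurableSet[m] {ω | i ∈ D ω})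
    (hN : ∀ i j, MeasurableSet[m] {ω | j ∈ N ω i}) (hq : ∀ i, Measurable[m] fun ω => q ω i)
    (hℓ : ∀ i, Measurable[m] fun ω => ℓ ω i) (hd : ∀ i, Measurable[m] fun ω => d ω i) (k : ι) :
    Measurable[m] fun ω => sqEstimate (D ω) (N ω) (q ω) (ℓ ω) (d ω) k := by
  have h : (fun ω => sqEstimate (D ω) (N ω) (q ω) (ℓ ω) (d ω) k) = fun ω => ∑ i,
      if i ∈ D ω then if k ∈ N ω i then q ω i * (ℓ ω i / d ω i) ^ 2 else 0 else 0 := by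
    ext ω
    rw [Finset.sum_ite_mem, Finset.univ_inter, sqEstimate]
  rw [h]
  exact Finset.measurable_sum _ fun i _ => Measurable.ite (hD i)
    (Measurable.ite (hN i k) ((hq i).mul (((hℓ i).div (hd i)).pow_const 2)) measurable_const)
    measurable_const

theorem measurable_sum_mem {Ω : Type*} [Fintype ι] {m : MeasurableSpace Ω} {N : Ω → Finset ι}
    {q : Ω → ι → ℝ} (hN : ∀ j, MeasurableSet[m] {ω | j ∈ N ω})
    (hq : ∀ i, Measurable[m] fun ω => q ω i) : Measurable[m] fun ω => ∑ j ∈ N ω, q ω j := by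
  have h : (fun ω => ∑ j ∈ N ω, q ω j) = fun ω => ∑ j, if j ∈ N ω then q ω j else 0 := by
    ext ω
    rw [Finset.sum_ite_mem, Finset.univ_inter]
  rw [h]
  exact Finset.measurable_sum _ fun j _ => Measurable.ite (hN j) (hq j) measurable_const

end SquaredEstimates

/-- The independence number of the looped nodes of a random graph is measurable. -/
theorem measurable_loopedIndepNum {Ω ι : Type*} [Fintype ι] {m : MeasurableSpace Ω}
    {N : Ω → ι → Finset ι} (hN : ∀ i j, MeasurableSet[m] {ω | j ∈ N ω i}) {α : Ω → ℝ}
    (hub : ∀ ω (A : Finset ι), (∀ i ∈ A, i ∈ N ω i) →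
      (∀ i ∈ A, ∀ j ∈ A, i ≠ j → i ∉ N ω j) → (A.card : ℝ) ≤ α ω)
    (hach : ∀ ω, ∃ A : Finset ι, (∀ i ∈ A, i ∈ N ω i) ∧
      (∀ i ∈ A, ∀ j ∈ A, i ≠ j → i ∉ N ω j) ∧ (A.card : ℝ) = α ω) : Measurable[m] α := by
  refine measurable_of_Ici fun c => ?_
  have h : α ⁻¹' Set.Ici c = ⋃ A : Finset ι, ⋃ _ : c ≤ (A.card : ℝ),
      (⋂ i ∈ A, {ω | i ∈ N ω i}) ∩ ⋂ i ∈ A, ⋂ j ∈ A, ⋂ _ : i ≠ j, {ω | i ∈ N ω j}ᶜ := by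
    ext ω
    simp only [Set.mem_preimage, Set.mem_Ici, Set.mem_iUnion, Set.mem_inter_iff, Set.mem_iInter,
      Set.mem_ofPred_eq, Set.mem_compl_iff, exists_prop]
    constructor
    · intro hc
      obtain ⟨A, h1, h2, h3⟩ := hach ω
      exact ⟨A, hc.trans_eq h3.symm, h1, h2⟩
    · rintro ⟨A, hc, h1, h2⟩
      exact hc.trans (hub ω A h1 h2)
  rw [h]
  refine MeasurableSet.iUnion fun A => MeasurableSet.iUnion fun _ => MeasurableSet.inter ?_ ?_
  · exact Finset.measurableSet_biInter _ fun i _ => hN i i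
  · exact Finset.measurableSet_biInter _ fun i _ => Finset.measurableSet_biInter _ fun j _ =>
      MeasurableSet.iInter fun _ => (hN j i).compl

theorem le_log_one_div_of_pos {δ : ℝ} (hδ : 0 < δ) : 1 - δ ≤ Real.log (1 / δ) := by
  have := Real.one_sub_inv_le_log_of_pos (one_div_pos.2 hδ)
  simpa using this

/-- High-probability control of the second moments of the importance-weighted losses, separately
for the nodes without and with a self-loop. -/
theorem one_sub_le_measureReal_sqEstimate {Ω ι : Type*} [Fintype ι] [DecidableEq ι]
    [MeasurableSpace ι] [MeasurableSingletonClass ι] {mΩ : MeasurableSpace Ω} {μ : Measure Ω}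
    [IsProbabilityMeasure μ] {ℱ : ℕ → MeasurableSpace Ω} {T : ℕ} {I : ℕ → Ω → ι}
    {p : ℕ → Ω → ι → ℝ} (hS : IsSampled μ ℱ T I p) (hT : 1 ≤ T) (hι : 2 ≤ Fintype.card ι)
    {N : ℕ → Ω → ι → Finset ι} {ℓ : ℕ → Ω → ι → ℝ}
    (hmp : ∀ n < T, ∀ i, Measurable[ℱ n] fun ω => p n ω i)
    (hmℓ : ∀ n < T, ∀ i, Measurable[ℱ n] fun ω => ℓ n ω i)
    (hmN : ∀ n < T, ∀ i j, MeasurableSet[ℱ n] {ω | j ∈ N n ω i})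
    (hℓ : ∀ n ω i, ℓ n ω i ∈ Set.Icc (0 : ℝ) 1) {α : ℕ → Ω → ℝ}
    (hub : ∀ n ω (A : Finset ι), (∀ i ∈ A, i ∈ N n ω i) →
      (∀ i ∈ A, ∀ j ∈ A, i ≠ j → i ∉ N n ω j) → (A.card : ℝ) ≤ α n ω)
    (hach : ∀ n ω, ∃ A : Finset ι, (∀ i ∈ A, i ∈ N n ω i) ∧
      (∀ i ∈ A, ∀ j ∈ A, i ≠ j → i ∉ N n ω j) ∧ (A.card : ℝ) = α n ω)
    {γ ε δ : ℝ} (hγ : 0 < γ) (hγ2 : γ ≤ 1 / 2) (hε : 0 < ε)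
    (hWε : ∀ n < T, ∀ ω i, i ∉ N n ω i → ε ≤ ∑ j ∈ N n ω i, p n ω j)
    (hδ : 0 < δ) (hδ1 : δ < 1) :
    1 - δ ≤ μ.real {ω |
      ε ^ 2 * ∑ n ∈ Finset.range T, sqEstimate (Finset.univ.filter fun i => i ∉ N n ω i) (N n ω)
        (p n ω) (ℓ n ω) (fun i => ∑ j ∈ N n ω i, p n ω j) (I n ω) ≤
          2 * T * ε + 2 * Real.log (2 / δ) ∧
      ∀ R, (∀ n < T, α n ω ≤ R) → (∃ n < T, α n ω = R) →
        ∑ n ∈ Finset.range T, sqEstimate (Finset.univ.filter fun i => i ∈ N n ω i) (N n ω)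
          (p n ω) (ℓ n ω) (fun i => ∑ j ∈ N n ω i, p n ω j + γ) (I n ω) ≤
          640 * Real.log ((Fintype.card ι : ℝ) * T / (γ * δ)) *
            (∑ n ∈ Finset.range T, α n ω + Real.log (1 / δ) * R / γ) + 1 / 2} := by
  set L := Real.log ((Fintype.card ι : ℝ) * T / (γ * δ)) with hL
  set κ := Real.log (1 / δ) with hκ
  set W : ℕ → Ω → ι → ℝ := fun n ω i => ∑ j ∈ N n ω i, p n ω j with hW
  have hW0 : ∀ n ω i, 0 ≤ W n ω i := fun n ω i => Finset.sum_nonneg fun j _ => hS.nonneg n ω j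
  have hmW : ∀ n < T, ∀ i, Measurable[ℱ n] fun ω => W n ω i := fun n hn i =>
    measurable_sum_mem (hmN n hn i) (hmp n hn)
  have hmα : ∀ n < T, Measurable[ℱ n] (α n) := fun n hn =>
    measurable_loopedIndepNum (hmN n hn) (hub n) (hach n)
  have hαnat : ∀ n ω, ∃ m : ℕ, α n ω = m ∧ m ≤ Fintype.card ι := fun n ω => by
    obtain ⟨A, -, -, h⟩ := hach n ω
    exact ⟨A.card, h.symm, A.card_le_univ⟩
  have hα0 : ∀ n ω, 0 ≤ α n ω := fun n ω => by
    obtain ⟨m, h, -⟩ := hαnat n ω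
    rw [h]
    positivity
  have hK : (2 : ℝ) ≤ Fintype.card ι := by exact_mod_cast hι
  have hT' : (1 : ℝ) ≤ T := by exact_mod_cast hT
  have hκδ : 1 - δ ≤ κ := le_log_one_div_of_pos hδ
  have hlogL : ∀ v, 0 < v → v * (γ * δ) ≤ (Fintype.card ι : ℝ) * T → Real.log v ≤ L := fun v hv h =>
    Real.log_le_log hv (by rwa [le_div_iff₀ (by positivity)])
  have hγδ : γ * δ ≤ 1 / 2 := by nlinarith
  have hKT : (2 : ℝ) ≤ Fintype.card ι * T := by nlinarith
  have hL1 : 1 ≤ L := by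
    refine le_trans ?_ (hlogL 4 (by norm_num) (by linarith))
    rw [show (4 : ℝ) = 2 ^ 2 by norm_num, Real.log_pow]
    have := Real.log_two_gt_d9
    push_cast
    linarith
  have hlγ0 : 0 ≤ Real.log (1 / γ) := Real.log_nonneg (by rw [le_div_iff₀ hγ]; linarith)
  have hlγ : Real.log (1 / γ) ≤ L := hlogL _ (by positivity) (by
    rw [show 1 / γ * (γ * δ) = δ by field_simp]; linarith)
  have hlK : Real.log (2 * Fintype.card ι / δ) ≤ L := hlogL _ (by positivity) (by
    rw [show 2 * (Fintype.card ι : ℝ) / δ * (γ * δ) = Fintype.card ι * (2 * γ) by field_simp]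
    gcongr
    linarith)
  have hαL : ∀ ω, Real.log (1 + ∑ n ∈ Finset.range T, α n ω) ≤ L := fun ω => by
    have h1 : ∑ n ∈ Finset.range T, α n ω ≤ Fintype.card ι * T := by
      calc _ ≤ ∑ n ∈ Finset.range T, (Fintype.card ι : ℝ) := Finset.sum_le_sum fun n _ => by
            obtain ⟨m, h, h'⟩ := hαnat n ω
            rw [h]
            exact_mod_cast h'
        _ = _ := by simp [mul_comm]
    have h2 : 0 ≤ ∑ n ∈ Finset.range T, α n ω := Finset.sum_nonneg fun n _ => hα0 n ω
    refine hlogL _ (by linarith) ?_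
    calc _ ≤ (1 + ∑ n ∈ Finset.range T, α n ω) * (1 / 2) := by gcongr
      _ ≤ _ := by linarith
  set x : ℕ → Ω → ι → ℝ := fun n ω k => ε ^ 2 *
    sqEstimate (Finset.univ.filter fun i => i ∉ N n ω i) (N n ω) (p n ω) (ℓ n ω) (W n ω) k with hx
  have hmx : ∀ n < T, ∀ k, Measurable[ℱ n] fun ω => x n ω k := fun n hn k =>
    (measurable_sqEstimate (fun i => by
      simp only [Finset.mem_filter, Finset.mem_univ, true_and]
      exact (hmN n hn i i).compl) (hmN n hn) (hmp n hn) (hmℓ n hn) (hmW n hn) k).const_mul _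
  have hx0 : ∀ n ω k, 0 ≤ x n ω k := fun n ω k =>
    mul_nonneg (sq_nonneg _) (sqEstimate_nonneg _ _ (hS.nonneg n ω) _ _ _)
  have hpD : ∀ n ω (D : Finset ι), ∑ i ∈ D, p n ω i ≤ 1 := fun n ω D => by
    rw [← hS.sum_eq_one n ω]
    exact Finset.sum_le_sum_of_subset_of_nonneg D.subset_univ fun i _ _ => hS.nonneg n ω i
  have hx1 : ∀ n < T, ∀ ω k, x n ω k ≤ 1 := fun n hn ω k => by
    calc x n ω k ≤ ε ^ 2 * ∑ i ∈ Finset.univ.filter fun i => i ∉ N n ω i,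
          p n ω i / W n ω i ^ 2 := by
          simp only [hx]
          gcongr
          exact sqEstimate_le _ _ (hS.nonneg n ω) (hℓ n ω) k
      _ ≤ ε ^ 2 * ∑ i ∈ Finset.univ.filter fun i => i ∉ N n ω i, p n ω i / ε ^ 2 := by
          gcongr with i hi
          · exact hS.nonneg n ω i
          · exact hWε n hn ω i (Finset.mem_filter.1 hi).2
      _ = ∑ i ∈ Finset.univ.filter fun i => i ∉ N n ω i, p n ω i := by
          rw [← Finset.sum_div]
          field_simp
      _ ≤ 1 := hpD _ _ _
  have hxm : ∀ n < T, ∀ ω, ∑ k, p n ω k * x n ω k ≤ ε := fun n hn ω => by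
    calc ∑ k, p n ω k * x n ω k = ε ^ 2 * ∑ k, p n ω k * sqEstimate
          (Finset.univ.filter fun i => i ∉ N n ω i) (N n ω) (p n ω) (ℓ n ω) (W n ω) k := by
          rw [Finset.mul_sum]
          exact Finset.sum_congr rfl fun k _ => by simp only [hx]; ring
      _ ≤ ε ^ 2 * ∑ i ∈ Finset.univ.filter fun i => i ∉ N n ω i, p n ω i / W n ω i := by
          gcongr
          exact sum_mul_sqEstimate_le _ _ (hS.nonneg n ω) (hℓ n ω)
            (fun i hi => hε.trans_le (hWε n hn ω i (Finset.mem_filter.1 hi).2)) fun i _ => le_rfl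
      _ ≤ ε ^ 2 * ∑ i ∈ Finset.univ.filter fun i => i ∉ N n ω i, p n ω i / ε := by
          gcongr with i hi
          · exact hS.nonneg n ω i
          · exact hWε n hn ω i (Finset.mem_filter.1 hi).2
      _ = ε * ∑ i ∈ Finset.univ.filter fun i => i ∉ N n ω i, p n ω i := by
          rw [← Finset.sum_div]
          field_simp
      _ ≤ ε * 1 := by
          gcongr
          exact hpD _ _ _
      _ = ε := mul_one ε
  set H : ℕ → Ω → Finset ι := fun n ω => Finset.univ.filter fun i => i ∈ N n ω i with hH
  set y : ℕ → Ω → Finset ι → ι → ℝ := fun n ω D k =>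
    sqEstimate D (N n ω) (p n ω) (ℓ n ω) (fun i => W n ω i + γ) k with hy
  have hmH : ∀ n < T, ∀ i, MeasurableSet[ℱ n] {ω | i ∈ H n ω} := fun n hn i => by
    simpa [hH] using hmN n hn i i
  have hmy : ∀ n < T, ∀ D : Ω → Finset ι, (∀ i, MeasurableSet[ℱ n] {ω | i ∈ D ω}) → ∀ k,
      Measurable[ℱ n] fun ω => y n ω (D ω) k := fun n hn D hD k =>
    measurable_sqEstimate hD (hmN n hn) (hmp n hn) (hmℓ n hn)
      (fun i => (hmW n hn i).add_const γ) k
  have hy0 : ∀ n ω D k, 0 ≤ y n ω D k := fun n ω D k => sqEstimate_nonneg _ _ (hS.nonneg n ω) _ _ _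
  have hyb : ∀ n ω D k, y n ω D k ≤ ∑ i ∈ D, p n ω i / (W n ω i + γ) ^ 2 := fun n ω D k =>
    sqEstimate_le _ _ (hS.nonneg n ω) (hℓ n ω) k
  have hym : ∀ n ω D, ∑ k, p n ω k * y n ω D k ≤ ∑ i ∈ D, p n ω i / (W n ω i + γ) := fun n ω D =>
    sum_mul_sqEstimate_le _ _ (hS.nonneg n ω) (hℓ n ω) (fun i _ => by linarith [hW0 n ω i])
      fun i _ => by simp only [hW]; linarith
  have hHself : ∀ n ω, ∀ i ∈ H n ω, i ∈ N n ω i := fun n ω i hi => (Finset.mem_filter.1 hi).2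
  have hbounds := fun n ω => looped_sum_bounds (N n ω) (p n ω) (hS.nonneg n ω) (hS.sum_eq_one n ω)
    (α n ω) (hub n ω) hγ hγ2
  have hlog2 : 0 < Real.log 2 := Real.log_pos (by norm_num)
  have hlogδ : Real.log 2 ≤ Real.log (2 / δ) := Real.log_le_log (by norm_num) (by
    rw [le_div_iff₀ hδ]; linarith)
  rcases le_total κ (1 / 2) with hκ2 | hκ2
  · have hκ0 : 0 < κ := by linarith
    set hi : ℕ → Ω → Finset ι := fun n ω => (H n ω).filter fun i => γ / κ ≤ W n ω i with hhi
    set lo : ℕ → Ω → Finset ι := fun n ω => (H n ω).filter fun i => ¬ γ / κ ≤ W n ω i with hlo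
    have hysplit : ∀ n ω k, y n ω (hi n ω) k + y n ω (lo n ω) k = y n ω (H n ω) k := fun n ω k =>
      sqEstimate_filter_add_filter_not _ _ _ _ _ _ _
    have hmle : ∀ n < T, ∀ i, MeasurableSet[ℱ n] {ω | γ / κ ≤ W n ω i} := fun n hn i =>
      hmW n hn i measurableSet_Ici
    have hmain := le_measureReal_of_truncated hS
      (hmy₁ := fun n hn => hmy n hn (hi n) fun i => by
        simp only [hhi, Finset.mem_filter]
        exact (hmH n hn i).inter (hmle n hn i))
      (hmy₂ := fun n hn => hmy n hn (lo n) fun i => by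
        simp only [hlo, Finset.mem_filter]
        exact (hmH n hn i).inter (hmle n hn i).compl)
      hmx hmα (fun n ω k => hy0 _ _ _ _) (fun n ω k => hy0 _ _ _ _) hx0 hx1 hxm hγ hκ0 hκ2 hL1
      (fun n ω => by
        obtain ⟨m, h, -⟩ := hαnat n ω
        rcases Nat.eq_zero_or_pos m with rfl | hm
        · left; simpa using h
        · right; rw [h]; exact_mod_cast hm) hαL
      (fun n _ ω k => (hyb _ _ _ _).trans ((hbounds n ω (hi n ω) fun i h =>
        hHself n ω i (Finset.mem_filter.1 h).1).2.2.2 κ hκ0 fun i h => (Finset.mem_filter.1 h).2))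
      (fun n _ ω => by
        simp only [hysplit]
        refine (hym _ _ _).trans ((hbounds n ω (H n ω) (hHself n ω)).1.trans ?_)
        have := hα0 n ω
        gcongr)
      (fun n _ ω => (hym _ _ _).trans ((hbounds n ω (lo n ω) fun i h =>
        hHself n ω i (Finset.mem_filter.1 h).1).2.2.1 κ hκ0 hκ2 fun i h =>
          (not_le.1 (Finset.mem_filter.1 h).2).le))
    refine hκδ.trans (hmain.trans (measureReal_mono ?_))
    rintro ω ⟨h1, h2⟩
    simp only [hysplit] at h2
    refine ⟨?_, fun R hR ⟨n, hn, hRn⟩ => h2 R (hRn ▸ hα0 n ω) hR⟩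
    rw [Finset.mul_sum]
    exact h1.trans (by linarith)
  · have hmain := one_sub_le_measureReal_of_le hS (y := fun n ω => y n ω (H n ω))
      (fun n hn => hmy n hn (H n) (hmH n hn)) hmx hmα (fun n ω k => hy0 _ _ _ _) hx0 hx1 hxm hγ
      hlγ0 hδ hα0 (fun n _ ω k => (hyb _ _ _ _).trans (hbounds n ω (H n ω) (hHself n ω)).2.1)
      (fun n _ ω => (hym _ _ _).trans (hbounds n ω (H n ω) (hHself n ω)).1)
      (N := Fintype.card ι) (by omega)
    refine hmain.trans (measureReal_mono ?_)
    rintro ω ⟨h1, h2⟩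
    refine ⟨?_, fun R hR ⟨n, hn, hRn⟩ => ?_⟩
    · rw [Finset.mul_sum]
      exact h1.trans (by linarith)
    · obtain ⟨m, hm, hmK⟩ := hαnat n ω
      have hA : 0 ≤ ∑ n ∈ Finset.range T, α n ω := Finset.sum_nonneg fun n _ => hα0 n ω
      have hR0 : 0 ≤ R := hRn ▸ hα0 n ω
      rcases Nat.eq_zero_or_pos m with rfl | hm0
      · refine le_trans (Finset.sum_nonpos fun s hs => ?_) (by positivity)
        refine (hyb s ω (H s ω) _).trans ((hbounds s ω (H s ω) (hHself s ω)).2.1.trans ?_)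
        have : α s ω ≤ 0 := by
          have := hR s (Finset.mem_range.1 hs)
          rw [← hRn, hm] at this
          simpa using this
        exact div_nonpos_of_nonpos_of_nonneg (by linarith) hγ.le
      · have hmR : (m : ℝ) = R := by rw [← hm, hRn]
        have h3 := h2 m (Finset.mem_Icc.2 ⟨hm0, hmK⟩) (by rw [hmR]; exact hR)
        rw [hmR] at h3
        refine h3.trans ?_
        have hRγ : 0 ≤ R / γ := by positivity
        have e1 : Real.log (1 / γ) * ∑ n ∈ Finset.range T, α n ω ≤
            L * ∑ n ∈ Finset.range T, α n ω := by gcongr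
        have e2 : R / γ * Real.log (2 * Fintype.card ι / δ) ≤ R / γ * L := by gcongr
        have e3 : L * (R / γ) * (1 / 2) ≤ L * (R / γ) * κ := by gcongr
        have e4 : 0 ≤ L * ∑ n ∈ Finset.range T, α n ω := by positivity
        have e5 : 0 ≤ L * (R / γ) := by positivity
        have e6 : 2 * R / γ * Real.log (2 * Fintype.card ι / δ) =
          2 * (R / γ * Real.log (2 * Fintype.card ι / δ)) := by ring
        have e7 : κ * R / γ = R / γ * κ := by ring
        rw [e6, e7]
        nlinarith

/-- Stability bound in the weakly observable setting (Lemma `weak_stability`): for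
exponential-weights iterates on the estimated losses, with `γ ∈ (0,1/2]`, exploration
level `ε ∈ (0,1)` guaranteeing `W_{t,i} ≥ ε` for nodes without a self-loop, learning
rate `η > 0`, and `α̃_t` the independence number of the subgraph of `G_t` induced on the
self-loop nodes `S_t`, for a universal constant `C`, with probability at least `1 − δ`,
simultaneously for every arm `j`,
`Σ_t ⟨p_t − e_j, ℓ̂_t⟩ ≤ (log K)/η + C log(KT/(γδ)) (η Σ_t α̃_t +
(η/γ)(max_t α̃_t) log(1/δ)) + η √((T/ε³) log(2/δ)) + (η/ε²) log(2/δ) + ηT/ε`. -/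
theorem stmt_10 :
    ∃ C : ℝ, 0 < C ∧
    ∀ (Ω : Type) (mΩ : MeasurableSpace Ω) (μ : Measure Ω)
      (hμ : IsProbabilityMeasure μ)
      (ℱ : ℕ → MeasurableSpace Ω) (hℱle : ∀ t, ℱ t ≤ mΩ) (hℱmono : Monotone ℱ)
      (K T : ℕ) (hK : 2 ≤ K) (hT : 1 ≤ T)
      (ℓ : ℕ → Ω → Fin K → ℝ)
      (hℓmem : ∀ t ω i, ℓ t ω i ∈ Set.Icc (0 : ℝ) 1)
      (hℓmeas : ∀ t, 1 ≤ t → t ≤ T → ∀ i, Measurable[ℱ (t - 1)] fun ω => ℓ t ω i)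
      (Nin : ℕ → Ω → Fin K → Finset (Fin K))
      (hNmeas : ∀ t, 1 ≤ t → t ≤ T → ∀ i j,
        MeasurableSet[ℱ (t - 1)] {ω | j ∈ Nin t ω i})
      (p : ℕ → Ω → Fin K → ℝ)
      (hpmeas : ∀ t, 1 ≤ t → t ≤ T → ∀ i, Measurable[ℱ (t - 1)] fun ω => p t ω i)
      (hpnn : ∀ t ω i, 0 ≤ p t ω i) (hpsum : ∀ t ω, ∑ i, p t ω i = 1)
      (I : ℕ → Ω → Fin K)
      (hImeas : ∀ t, 1 ≤ t → t ≤ T → Measurable[ℱ t] (I t))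
      (hIlaw : ∀ t, 1 ≤ t → t ≤ T → ∀ i,
        (μ[fun ω => Set.indicator {ω' | I t ω' = i} (fun _ => (1 : ℝ)) ω | ℱ (t - 1)])
          =ᵐ[μ] fun ω => p t ω i)
      (W : ℕ → Ω → Fin K → ℝ)
      (hW : ∀ t ω i, W t ω i = ∑ j ∈ Nin t ω i, p t ω j)
      (γ : ℝ) (hγ0 : 0 < γ) (hγhalf : γ ≤ 1 / 2)
      (ε : ℝ) (hε0 : 0 < ε) (hε1 : ε < 1)
      (hWε : ∀ t, 1 ≤ t → t ≤ T → ∀ ω i, i ∉ Nin t ω i → ε ≤ W t ω i)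
      (η : ℝ) (hη : 0 < η)
      (ℓhat : ℕ → Ω → Fin K → ℝ)
      (hℓhat : ∀ t ω i, ℓhat t ω i =
        if I t ω ∈ Nin t ω i then
          (if i ∈ Nin t ω i then ℓ t ω i / (W t ω i + γ) else ℓ t ω i / W t ω i)
        else 0)
      -- exponential-weights iterates on the estimated losses
      (hp1 : ∀ ω i, p 1 ω i = 1 / K)
      (hupdate : ∀ t, 1 ≤ t → t ≤ T → ∀ ω i,
        p (t + 1) ω i = p t ω i * Real.exp (-η * ℓhat t ω i) /
          ∑ j, p t ω j * Real.exp (-η * ℓhat t ω j))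
      -- `αt t ω` is the independence number of the subgraph of `G_t` induced on `S_t`
      (αt : ℕ → Ω → ℝ)
      (hαub : ∀ t ω (A : Finset (Fin K)), (∀ i ∈ A, i ∈ Nin t ω i) →
        (∀ i ∈ A, ∀ j ∈ A, i ≠ j → i ∉ Nin t ω j) → (A.card : ℝ) ≤ αt t ω)
      (hαach : ∀ t ω, ∃ A : Finset (Fin K), (∀ i ∈ A, i ∈ Nin t ω i) ∧
        (∀ i ∈ A, ∀ j ∈ A, i ≠ j → i ∉ Nin t ω j) ∧ (A.card : ℝ) = αt t ω)
      (δ : ℝ) (hδ0 : 0 < δ) (hδ1 : δ < 1),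
      ENNReal.ofReal (1 - δ) ≤
        μ {ω | ∀ j : Fin K,
          ∑ t ∈ Finset.Icc 1 T,
            ∑ i, (p t ω i - (if i = j then (1 : ℝ) else 0)) * ℓhat t ω i ≤
            Real.log K / η +
            C * Real.log ((K : ℝ) * T / (γ * δ)) *
              (η * (∑ t ∈ Finset.Icc 1 T, αt t ω) +
                (η / γ) *
                  ((Finset.Icc 1 T).sup' (Finset.nonempty_Icc.mpr hT) fun t => αt t ω) *
                  Real.log (1 / δ)) +
            η * Real.sqrt ((T / ε ^ 3) * Real.log (2 / δ)) +
            (η / ε ^ 2) * Real.log (2 / δ) + η * T / ε} := by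
  refine ⟨320, by norm_num, ?_⟩
  intro Ω mΩ μ hμ ℱ hℱle hℱmono K T hK hT ℓ hℓmem hℓmeas Nin hNmeas p hpmeas hpnn hpsum I hImeas
    hIlaw W hW γ hγ0 hγhalf ε hε0 hε1 hWε η hη ℓhat hℓhat hp1 hupdate αt hαub hαach δ hδ0 hδ1
  have hS : IsSampled μ ℱ T (fun n => I (n + 1)) (fun n => p (n + 1)) :=
    ⟨hℱle, hℱmono, fun n hn => hImeas (n + 1) (by omega) hn, fun n => hpnn (n + 1),
      fun n => hpsum (n + 1), fun n hn => hIlaw (n + 1) (by omega) hn⟩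
  have hmain := one_sub_le_measureReal_sqEstimate hS hT (by simpa using hK)
    (N := fun n => Nin (n + 1)) (ℓ := fun n => ℓ (n + 1)) (α := fun n => αt (n + 1))
    (fun n hn => hpmeas (n + 1) (by omega) hn) (fun n hn => hℓmeas (n + 1) (by omega) hn)
    (fun n hn => hNmeas (n + 1) (by omega) hn) (fun n => hℓmem (n + 1)) (fun n => hαub (n + 1))
    (fun n => hαach (n + 1)) hγ0 hγhalf hε0
    (fun n hn ω i hi => hW (n + 1) ω i ▸ hWε (n + 1) (by omega) hn ω i hi) hδ0 hδ1
  refine ENNReal.ofReal_le_of_le_toReal (hmain.trans (measureReal_mono ?_))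
  rintro ω ⟨hX, hY⟩ j
  have hW0 : ∀ t i, 0 ≤ W t ω i := fun t i => by
    rw [hW]
    exact Finset.sum_nonneg fun j _ => hpnn t ω j
  have hℓhat0 : ∀ t i, 0 ≤ ℓhat t ω i := fun t i => by
    have h1 := (hℓmem t ω i).1
    have h2 := hW0 t i
    rw [hℓhat]
    split_ifs <;> positivity
  have hreg := exp_weights_regret (by omega) hη (p := fun t i => p t ω i)
    (l := fun t i => ℓhat t ω i) (T := T) (fun t i => hpnn t ω i) (fun t => hpsum t ω) hℓhat0
    (fun i => hp1 ω i) (fun t h1 h2 i => hupdate t h1 h2 ω i) j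
  refine hreg.trans ?_
  have hsum : ∀ f : ℕ → ℝ, ∑ t ∈ Finset.Icc 1 T, f t = ∑ n ∈ Finset.range T, f (n + 1) := fun f => by
    rw [Finset.range_eq_Ico, Finset.sum_Ico_add' f 0 T 1]
    rfl
  have hsq : ∀ t, ∑ i, p t ω i * ℓhat t ω i ^ 2 =
      sqEstimate (Finset.univ.filter fun i => i ∉ Nin t ω i) (Nin t ω) (p t ω) (ℓ t ω)
        (fun i => ∑ j ∈ Nin t ω i, p t ω j) (I t ω) +
      sqEstimate (Finset.univ.filter fun i => i ∈ Nin t ω i) (Nin t ω) (p t ω) (ℓ t ω)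
        (fun i => ∑ j ∈ Nin t ω i, p t ω j + γ) (I t ω) := fun t => by
    rw [sqEstimate, sqEstimate, Finset.sum_filter, Finset.sum_filter, ← Finset.sum_add_distrib]
    refine Finset.sum_congr rfl fun i _ => ?_
    rw [hℓhat, ← hW]
    by_cases h1 : i ∈ Nin t ω i <;> by_cases h2 : I t ω ∈ Nin t ω i <;> simp [h1, h2]
  set R := (Finset.Icc 1 T).sup' (Finset.nonempty_Icc.mpr hT) fun t => αt t ω with hR
  have hYR := hY R
    (fun n hn => Finset.le_sup' (fun t => αt t ω) (Finset.mem_Icc.2 ⟨by omega, by omega⟩)) (by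
      obtain ⟨t, ht, h⟩ := Finset.exists_mem_eq_sup' (Finset.nonempty_Icc.mpr hT) fun t => αt t ω
      have := Finset.mem_Icc.1 ht
      refine ⟨t - 1, by omega, ?_⟩
      simp only [Nat.sub_add_cancel this.1]
      exact h.symm)
  rw [Fintype.card_fin] at hYR
  simp only [hsq]
  rw [Finset.sum_add_distrib, hsum, hsum, hsum]
  set SX := ∑ n ∈ Finset.range T, sqEstimate (Finset.univ.filter fun i => i ∉ Nin (n + 1) ω i)
    (Nin (n + 1) ω) (p (n + 1) ω) (ℓ (n + 1) ω) (fun i => ∑ j ∈ Nin (n + 1) ω i, p (n + 1) ω j)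
    (I (n + 1) ω)
  set SY := ∑ n ∈ Finset.range T, sqEstimate (Finset.univ.filter fun i => i ∈ Nin (n + 1) ω i)
    (Nin (n + 1) ω) (p (n + 1) ω) (ℓ (n + 1) ω)
    (fun i => ∑ j ∈ Nin (n + 1) ω i, p (n + 1) ω j + γ) (I (n + 1) ω)
  set A := ∑ n ∈ Finset.range T, αt (n + 1) ω
  set L := Real.log ((K : ℝ) * T / (γ * δ))
  set κ := Real.log (1 / δ)
  have hl : 1 / 2 ≤ Real.log (2 / δ) := by
    have h1 : Real.log 2 ≤ Real.log (2 / δ) := Real.log_le_log (by norm_num) (by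
      rw [le_div_iff₀ hδ0]; linarith)
    have := Real.log_two_gt_d9
    linarith
  set l := Real.log (2 / δ)
  have hT' : (1 : ℝ) ≤ T := by exact_mod_cast hT
  have hsqrt : 1 / 4 ≤ Real.sqrt (T / ε ^ 3 * l) := by
    refine Real.le_sqrt_of_sq_le ?_
    have h1 : 1 ≤ (T : ℝ) / ε ^ 3 := by
      rw [le_div_iff₀ (by positivity), one_mul]
      exact (pow_le_one₀ hε0.le hε1.le).trans hT'
    nlinarith
  have hX' : η / 2 * SX ≤ η * T / ε + η / ε ^ 2 * l := by
    calc η / 2 * SX = η / 2 / ε ^ 2 * (ε ^ 2 * SX) := by field_simp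
      _ ≤ η / 2 / ε ^ 2 * (2 * T * ε + 2 * l) := by gcongr
      _ = _ := by field_simp
  have hY' : η / 2 * SY ≤ 320 * L * (η * A + η / γ * R * κ) + η * (1 / 4) := by
    calc η / 2 * SY ≤ η / 2 * (640 * L * (A + κ * R / γ) + 1 / 2) := by gcongr
      _ = _ := by ring
  have hs' := mul_le_mul_of_nonneg_left hsqrt hη.le
  rw [mul_add]
  linarith
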